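/- Assume the Riemann hypothesis. Then there exists B > 0 such that for all sufficiently large T, with m := ⌊B·ln(ln T)/ln(ln(ln T))⌋, there exist points s₀ < s₁ < … < s_m, all lying in the open interval (T, T + 1/ln(ln(ln T))), such that Z'(s_{i})·Z'(s_{i+1}) < 0 for every i = 0, …, m−1; in particular this interval contains at least m roots of odd order of Z'(t) = 0. -/

import Mathlib

open Filter Topology

noncomputable def theta (t : ℝ) : ℝ :=
  (Complex.log (Complex.Gamma (1/4 + Complex.I * t / 2))).im - t / 2 * Real.log Real.pi

noncomputable def hardyZ (t : ℝ) : ℝ :=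
  (Complex.exp (Complex.I * theta t) * riemannZeta (1/2 + Complex.I * t)).re

/-- A lower bound for a nonvanishing holomorphic function on a disc. -/
lemma norm_lower_bound_of_ne_zero_on_ball {f : ℂ → ℂ} {c : ℂ} {R M : ℝ} (hR : 0 < R)
    (hf : DifferentiableOn ℂ f (Metric.ball c R)) (hf0 : ∀ z ∈ Metric.ball c R, f z ≠ 0)
    (hM : ∀ z ∈ Metric.ball c R, ‖f z‖ ≤ M) {z : ℂ} (hz : z ∈ Metric.ball c R) :
    ‖f c‖ * Real.exp (-(2 * (Real.log (M / ‖f c‖) + 1) * ‖z - c‖ / (R - ‖z - c‖))) ≤ ‖f z‖ := by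
  have hc : c ∈ Metric.ball c R := Metric.mem_ball_self hR
  have hfc : 0 < ‖f c‖ := norm_pos_iff.2 (hf0 c hc)
  have hderiv : DifferentiableOn ℂ (fun z => deriv f z / f z) (Metric.ball c R) :=
    (hf.deriv Metric.isOpen_ball).div hf hf0
  obtain ⟨g, hg⟩ := hderiv.isExactOn_ball.with_val_at c 0
  obtain ⟨hgc, hg⟩ := hg
  have hconst : ∀ w ∈ Metric.ball c R, f w = f c * Complex.exp (g w) := by
    intro w hw
    have hd : ∀ x ∈ Metric.ball c R,
        HasDerivAt (fun x => f x * Complex.exp (-g x)) 0 x := by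
      intro x hx
      have h1 := (hf.differentiableAt (Metric.isOpen_ball.mem_nhds hx)).hasDerivAt
      have h2 := (hg x hx).neg.cexp
      refine (h1.mul h2).congr_deriv ?_
      have h3 : f x * (deriv f x / f x) = deriv f x := mul_div_cancel₀ _ (hf0 x hx)
      linear_combination -Complex.exp (-g x) * h3
    have := Metric.isOpen_ball.is_const_of_deriv_eq_zero
      (convex_ball c R).isPreconnected
      (fun x hx => (hd x hx).differentiableAt.differentiableWithinAt)
      (fun x hx => (hd x hx).deriv) hw hc
    simp only [hgc, neg_zero, Complex.exp_zero, mul_one] at this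
    rw [← this, mul_assoc, ← Complex.exp_add]
    simp
  have hMc := hM c hc
  have hL : 0 < Real.log (M / ‖f c‖) + 1 := by
    have : 0 ≤ Real.log (M / ‖f c‖) := Real.log_nonneg ((one_le_div hfc).2 hMc)
    linarith
  have hball : ∀ x ∈ Metric.ball (0 : ℂ) R, x + c ∈ Metric.ball c R := by
    intro x hx
    simpa [dist_eq_norm] using hx
  have hbc := Complex.borelCaratheodory_zero (f := fun x => g (x + c)) (z := z - c) hL (R := R)
    (fun x hx => ((hg _ (hball x hx)).differentiableAt.comp x
      (by fun_prop)).differentiableWithinAt)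
    (fun x hx => by
      have h1 := hM _ (hball x hx)
      rw [hconst _ (hball x hx), norm_mul, Complex.norm_exp] at h1
      have h2 : Real.exp (g (x + c)).re ≤ M / ‖f c‖ := by
        rw [le_div_iff₀ hfc]; linarith
      have := (Real.le_log_iff_exp_le (lt_of_lt_of_le (Real.exp_pos _) h2)).2 h2
      show (g (x + c)).re ≤ _
      linarith) hR (by simpa [dist_eq_norm] using hz) (by simpa using hgc)
  simp only [sub_add_cancel] at hbc
  rw [hconst z hz, norm_mul, Complex.norm_exp]
  gcongr
  have := (abs_le.1 (Complex.abs_re_le_norm (g z))).1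
  linarith

/-- A holomorphic function with nonnegative real part on a half-plane grows at most linearly
compared with its values on a vertical line. -/
lemma norm_le_of_re_nonneg_on_half_plane {H : ℂ → ℂ} {α β : ℝ}
    (hH : DifferentiableOn ℂ H {s | α < s.re}) (hre : ∀ s : ℂ, α < s.re → 0 ≤ (H s).re)
    {s : ℂ} (h1 : α < s.re) (h2 : s.re ≤ β) :
    ‖H s‖ ≤ (2 + 2 * ‖H (β + s.im * Complex.I)‖) * (β - α) / (s.re - α) := by
  set c : ℂ := β + s.im * Complex.I with hc
  have hsub : ∀ x ∈ Metric.ball (0 : ℂ) (β - α), α < (x + c).re := by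
    intro x hx
    have h3 : ‖x‖ < β - α := by simpa using hx
    have := (abs_le.1 (Complex.abs_re_le_norm x)).1
    simp [hc]
    linarith
  have hsc : ‖s - c‖ = β - s.re := by
    have : s - c = ((s.re - β : ℝ) : ℂ) := by
      apply Complex.ext <;> simp [hc]
    rw [this, Complex.norm_real, Real.norm_eq_abs, abs_of_nonpos] <;> linarith
  have hmem : s - c ∈ Metric.ball (0 : ℂ) (β - α) := by
    simp [hsc]; linarith
  have hbc := Complex.borelCaratheodory (f := fun x => -H (x + c)) (z := s - c) one_pos
    (R := β - α)
    (fun x hx => by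
      have := hH.differentiableAt ((isOpen_lt continuous_const Complex.continuous_re).mem_nhds
        (hsub x hx))
      exact (DifferentiableAt.comp x this (f := fun x => x + c)
        (by fun_prop)).neg.differentiableWithinAt)
    (fun x hx => by
      have := hre _ (hsub x hx)
      simp at this ⊢
      linarith) (by linarith) hmem
  simp only [sub_add_cancel, norm_neg, zero_add, hsc] at hbc
  have h4 : β - α - (β - s.re) = s.re - α := by ring
  rw [h4, ← add_div] at hbc
  refine hbc.trans ?_
  have h5 : 0 < s.re - α := by linarith
  gcongr
  have := norm_nonneg (H c)
  nlinarith [mul_nonneg this h5.le]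

/-- Shifting a vertical line of integration. -/
lemma integral_vertical_line_eq {f : ℂ → ℂ} {a b C : ℝ} (hab : a ≤ b)
    (hf : ∀ s : ℂ, a ≤ s.re → s.re ≤ b → DifferentiableAt ℂ f s)
    (hC : ∀ s : ℂ, a ≤ s.re → s.re ≤ b → ‖f s‖ ≤ C / (1 + s.im ^ 2)) :
    MeasureTheory.Integrable (fun t : ℝ => f (a + t * Complex.I)) ∧
    ∫ t : ℝ, f (a + t * Complex.I) = ∫ t : ℝ, f (b + t * Complex.I) := by
  have hinteg : ∀ x : ℝ, a ≤ x → x ≤ b →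
      MeasureTheory.Integrable (fun t : ℝ => f (x + t * Complex.I)) := by
    intro x h1 h2
    refine MeasureTheory.Integrable.mono' (g := fun t : ℝ => C * (1 + t ^ 2)⁻¹)
      (integrable_inv_one_add_sq.const_mul C) ?_ ?_
    · refine Continuous.aestronglyMeasurable ?_
      refine continuous_iff_continuousAt.2 fun t => ?_
      exact ContinuousAt.comp (f := fun t : ℝ => (x + t * Complex.I : ℂ))
        (hf _ (by simpa using h1) (by simpa using h2)).continuousAt (by fun_prop)
    · refine Eventually.of_forall fun t => ?_
      have := hC (x + t * Complex.I) (by simpa using h1) (by simpa using h2)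
      simpa [div_eq_mul_inv] using this
  refine ⟨hinteg a le_rfl hab, ?_⟩
  have hlim : ∀ x : ℝ, a ≤ x → x ≤ b → Tendsto (fun R : ℝ => ∫ t in (-R)..R, f (x + t * Complex.I))
      atTop (𝓝 (∫ t : ℝ, f (x + t * Complex.I))) := fun x h1 h2 =>
    MeasureTheory.intervalIntegral_tendsto_integral (hinteg x h1 h2) tendsto_neg_atTop_atBot tendsto_id
  have hside : ∀ e : ℝ → ℝ, (∀ R, (e R) ^ 2 = R ^ 2) →
      Tendsto (fun R : ℝ => ∫ x in a..b, f (x + e R * Complex.I)) atTop (𝓝 0) := by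
    intro e he
    have h0 : Tendsto (fun R : ℝ => C / (1 + R ^ 2) * |b - a|) atTop (𝓝 0) := by
      have : Tendsto (fun R : ℝ => 1 + R ^ 2) atTop atTop :=
        tendsto_atTop_add_const_left _ _ (tendsto_pow_atTop two_ne_zero)
      simpa using (this.const_div_atTop C).mul_const |b - a|
    refine squeeze_zero_norm (fun R => ?_) h0
    refine intervalIntegral.norm_integral_le_of_norm_le_const fun x hx => ?_
    rw [Set.uIoc_of_le hab] at hx
    have := hC (x + e R * Complex.I) (by simpa using hx.1.le) (by simpa using hx.2)
    simpa [he] using this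
  have hrect : ∀ R : ℝ, (∫ t in (-R)..R, f (b + t * Complex.I)) -
      (∫ t in (-R)..R, f (a + t * Complex.I)) =
      Complex.I * ((∫ x in a..b, f (x + (-R : ℝ) * Complex.I)) -
        ∫ x in a..b, f (x + (R : ℝ) * Complex.I)) := by
    intro R
    have h := Complex.integral_boundary_rect_eq_zero_of_differentiableOn f
      (a + (-R : ℝ) * Complex.I) (b + (R : ℝ) * Complex.I) (fun s hs => by
        rw [Complex.mem_reProdIm] at hs
        have h1 := hs.1
        simp [Set.uIcc_of_le hab] at h1
        exact (hf s h1.1 h1.2).differentiableWithinAt)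
    simp at h
    have hI : Complex.I * Complex.I = -1 := Complex.I_mul_I
    simp only [Complex.ofReal_neg, neg_mul]
    linear_combination (-Complex.I) * h +
      ((∫ t in (-R)..R, f (b + t * Complex.I)) - (∫ t in (-R)..R, f (a + t * Complex.I))) * hI
  have h1 := (hlim b hab le_rfl).sub (hlim a le_rfl hab)
  have h2 : Tendsto (fun R : ℝ => Complex.I * ((∫ x in a..b, f (x + (-R : ℝ) * Complex.I)) -
        ∫ x in a..b, f (x + (R : ℝ) * Complex.I))) atTop (𝓝 0) := by
    simpa using ((hside (fun R => -R) (by simp)).sub (hside (fun R => R) (by simp))).const_mul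
      Complex.I
  have h3 := tendsto_nhds_unique (h1.congr hrect) h2
  exact (sub_eq_zero.1 h3).symm

lemma hasDerivAt_comp_add_ofReal {f : ℂ → ℂ} {z : ℂ} {u : ℝ} (hf : DifferentiableAt ℂ f (z + u)) :
    HasDerivAt (fun a : ℝ => f (z + a)) (deriv f (z + u)) u :=
  (HasDerivAt.comp_const_add z (u : ℂ) hf.hasDerivAt).comp_ofReal

lemma hasDerivAt_log_norm_sq_comp_add_ofReal {f : ℂ → ℂ} {z : ℂ} {u : ℝ}
    (hf : DifferentiableAt ℂ f (z + u)) (h0 : f (z + u) ≠ 0) :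
    HasDerivAt (fun a : ℝ => Real.log (‖f (z + a)‖ ^ 2)) (2 * (logDeriv f (z + u)).re) u := by
  have h2 := (hasDerivAt_comp_add_ofReal hf).norm_sq.log (by simpa using h0)
  refine h2.congr_deriv ?_
  rw [logDeriv_apply, Complex.inner, Complex.div_re, Complex.normSq_eq_norm_sq]
  simp
  ring

/-- The second-order ratio of Gamma values is close to `1`. -/
lemma norm_Gamma_ratio_sub_one_le {z w : ℂ} {a : ℝ} (ha : 0 < a) (hz : 2 ≤ z.re) (hw : 2 ≤ w.re) :
    ‖Complex.Gamma (z + a) * Complex.Gamma w / (Complex.Gamma z * Complex.Gamma (w + a)) - 1‖ ≤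
      Real.exp (a * ‖z - w‖) - 1 := by
  have hpos : ∀ x : ℂ, 2 ≤ x.re → Complex.Gamma x ≠ 0 := fun x hx =>
    Complex.Gamma_ne_zero_of_re_pos (by linarith)
  have hza : 2 ≤ (z + a).re := by simp; linarith
  have hwa : 2 ≤ (w + a).re := by simp; linarith
  have hlim := ((((Complex.GammaSeq_tendsto_Gamma (z + a)).mul
    (Complex.GammaSeq_tendsto_Gamma w)).div ((Complex.GammaSeq_tendsto_Gamma z).mul
    (Complex.GammaSeq_tendsto_Gamma (w + a))) (mul_ne_zero (hpos _ hz) (hpos _ hwa))).sub_const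
      1).norm
  refine le_of_tendsto hlim ?_
  filter_upwards [eventually_gt_atTop 0] with n hn
  have hne : ∀ x : ℂ, 2 ≤ x.re → ∀ j : ℕ, x + j ≠ 0 := by
    intro x hx j h
    have := congrArg Complex.re h
    simp at this
    have h2 : (0 : ℝ) ≤ j := by positivity
    linarith
  have hnorm : ∀ x : ℂ, 2 ≤ x.re → ∀ j : ℕ, (j : ℝ) + 2 ≤ ‖x + j‖ := by
    intro x hx j
    refine le_trans ?_ (Complex.re_le_norm _)
    simp; linarith
  have hn0 : (n : ℂ) ≠ 0 := by exact_mod_cast hn.ne'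
  have hprod : Complex.GammaSeq (z + a) n * Complex.GammaSeq w n /
      (Complex.GammaSeq z n * Complex.GammaSeq (w + a) n) =
      ∏ j ∈ Finset.range (n + 1), (1 + a * (w - z) / ((z + a + j) * (w + j)) * (-1)) := by
    have hfac : ∀ j ∈ Finset.range (n + 1),
        (1 + a * (w - z) / ((z + a + j) * (w + j)) * (-1)) =
        ((z + j) * (w + a + j)) / ((z + a + j) * (w + j)) := by
      intro j _
      have h1 := hne _ hza j
      have h2 := hne _ hw j
      field_simp
      ring
    rw [Finset.prod_congr rfl hfac, Finset.prod_div_distrib, Finset.prod_mul_distrib,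
      Finset.prod_mul_distrib]
    have p1 := Finset.prod_ne_zero_iff.2 fun j (_ : j ∈ Finset.range (n + 1)) => hne _ hz j
    have p2 := Finset.prod_ne_zero_iff.2 fun j (_ : j ∈ Finset.range (n + 1)) => hne _ hza j
    have p3 := Finset.prod_ne_zero_iff.2 fun j (_ : j ∈ Finset.range (n + 1)) => hne _ hw j
    have p4 := Finset.prod_ne_zero_iff.2 fun j (_ : j ∈ Finset.range (n + 1)) => hne _ hwa j
    simp only [Complex.GammaSeq]
    rw [Complex.cpow_add _ _ hn0, Complex.cpow_add _ _ hn0]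
    have q1 : (n : ℂ) ^ z ≠ 0 := by simp [Complex.cpow_eq_zero_iff, hn0]
    have q2 : (n : ℂ) ^ w ≠ 0 := by simp [Complex.cpow_eq_zero_iff, hn0]
    have q3 : (n : ℂ) ^ (a : ℂ) ≠ 0 := by simp [Complex.cpow_eq_zero_iff, hn0]
    have q4 : ((n.factorial : ℕ) : ℂ) ≠ 0 := by exact_mod_cast n.factorial_ne_zero
    field_simp
  simp only [Pi.div_apply]
  rw [hprod]
  refine (Finset.norm_prod_one_add_sub_one_le _ _).trans ?_
  gcongr
  have hterm : ∀ j ∈ Finset.range (n + 1),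
      ‖a * (w - z) / ((z + a + j) * (w + j)) * (-1)‖ ≤
        a * ‖z - w‖ * (1 / ((j : ℝ) + 1) - 1 / ((j + 1 : ℕ) + 1)) := by
    intro j _
    have h1 := hnorm _ hza j
    have h2 := hnorm _ hw j
    have h3 : (0 : ℝ) ≤ j := by positivity
    rw [mul_neg_one, norm_neg, norm_div, norm_mul, norm_mul, Complex.norm_real, Real.norm_eq_abs,
      abs_of_pos ha, norm_sub_rev w z, div_eq_mul_inv]
    gcongr
    have h4 : (1 / ((j : ℝ) + 1) - 1 / ((j + 1 : ℕ) + 1)) = (((j : ℝ) + 1) * (j + 2))⁻¹ := by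
      push_cast
      field_simp
      ring
    rw [h4]
    gcongr
    linarith
  refine (Finset.sum_le_sum hterm).trans ?_
  rw [← Finset.mul_sum, Finset.sum_range_sub' (fun j : ℕ => 1 / ((j : ℝ) + 1))]
  have h5 : 0 ≤ a * ‖z - w‖ := by positivity
  have h6 : (0 : ℝ) ≤ 1 / ((n + 1 : ℕ) + 1) := by positivity
  simp only [Nat.cast_zero, zero_add, div_one]
  nlinarith

lemma differentiableAt_Gamma_of_two_le_re {z : ℂ} (hz : 2 ≤ z.re) :
    DifferentiableAt ℂ Complex.Gamma z := by
  refine Complex.differentiableAt_Gamma z fun m h => ?_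
  have := congrArg Complex.re h
  simp at this
  have h2 : (0 : ℝ) ≤ m := by positivity
  linarith

/-- The digamma function is `1`-Lipschitz on `2 ≤ re z`. -/
lemma norm_digamma_sub_digamma_le {z w : ℂ} (hz : 2 ≤ z.re) (hw : 2 ≤ w.re) :
    ‖Complex.digamma z - Complex.digamma w‖ ≤ ‖z - w‖ := by
  have hGz : Complex.Gamma z ≠ 0 := Complex.Gamma_ne_zero_of_re_pos (by linarith)
  have hGw : Complex.Gamma w ≠ 0 := Complex.Gamma_ne_zero_of_re_pos (by linarith)
  have hshift : ∀ x : ℂ, 2 ≤ x.re → HasDerivAt (fun a : ℝ => Complex.Gamma (x + a))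
      (deriv Complex.Gamma x) 0 := by
    intro x hx
    have h := hasDerivAt_comp_add_ofReal (f := Complex.Gamma) (z := x) (u := 0)
      (by simpa using differentiableAt_Gamma_of_two_le_re hx)
    simpa using h
  have hd : HasDerivAt (fun a : ℝ => Complex.Gamma (z + a) * Complex.Gamma w /
      (Complex.Gamma z * Complex.Gamma (w + a))) (Complex.digamma z - Complex.digamma w) 0 := by
    have h := ((hshift z hz).mul_const (Complex.Gamma w)).div
      ((hshift w hw).const_mul (Complex.Gamma z)) (by simpa using ⟨hGz, hGw⟩)
    refine h.congr_deriv ?_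
    simp only [Complex.digamma_def, logDeriv_apply, Complex.ofReal_zero, add_zero]
    field_simp
  have hd2 : HasDerivAt (fun a : ℝ => Real.exp (a * ‖z - w‖)) (‖z - w‖) 0 := by
    have := ((hasDerivAt_id (0 : ℝ)).mul_const ‖z - w‖).exp
    simpa using this
  have t1 := (hasDerivAt_iff_tendsto_slope_zero.1 hd).mono_left
    (nhdsWithin_mono (0 : ℝ) (s := Set.Ioi 0) (fun x hx => ne_of_gt hx))
  have t2 := (hasDerivAt_iff_tendsto_slope_zero.1 hd2).mono_left
    (nhdsWithin_mono (0 : ℝ) (s := Set.Ioi 0) (fun x hx => ne_of_gt hx))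
  refine le_of_tendsto_of_tendsto t1.norm t2 ?_
  filter_upwards [self_mem_nhdsWithin] with a ha
  have ha : 0 < a := ha
  have h := norm_Gamma_ratio_sub_one_le ha hz hw
  rw [norm_smul, norm_inv, Real.norm_eq_abs, abs_of_pos ha]
  simp only [zero_add, Complex.ofReal_zero, add_zero, zero_mul, Real.exp_zero, smul_eq_mul]
  rw [div_self (mul_ne_zero hGz hGw)]
  gcongr

/-- A lower bound for the real part of the digamma function. -/
lemma log_norm_sub_one_le_digamma_re {z : ℂ} (hz : 2 ≤ z.re) :
    Real.log ‖z‖ - 1 ≤ (Complex.digamma z).re := by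
  have hre : ∀ u : ℝ, 0 ≤ u → 2 ≤ (z + u).re := fun u hu => by simp; linarith
  have hne : ∀ u : ℝ, 0 ≤ u → Complex.Gamma (z + u) ≠ 0 := fun u hu =>
    Complex.Gamma_ne_zero_of_re_pos (by linarith [hre u hu])
  have hz0 : z ≠ 0 := by rintro rfl; simp at hz; linarith
  have hlog : ∀ u : ℝ, 0 ≤ u → HasDerivAt (fun a : ℝ => Real.log (‖Complex.Gamma (z + a)‖ ^ 2))
      (2 * (Complex.digamma (z + u)).re) u := fun u hu =>
    hasDerivAt_log_norm_sq_comp_add_ofReal (differentiableAt_Gamma_of_two_le_re (hre u hu))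
      (hne u hu)
  obtain ⟨u, hu, hmv⟩ := exists_hasDerivAt_eq_slope
    (fun a : ℝ => Real.log (‖Complex.Gamma (z + a)‖ ^ 2))
    (fun u => 2 * (Complex.digamma (z + u)).re) (zero_lt_one)
    (fun u hu => (hlog u hu.1).continuousAt.continuousWithinAt) (fun u hu => hlog u hu.1.le)
  have hG := Complex.Gamma_add_one z hz0
  simp only [Complex.ofReal_one, Complex.ofReal_zero, add_zero, hG, sub_zero, div_one,
    norm_mul, mul_pow] at hmv
  have hG0 : ‖Complex.Gamma z‖ ≠ 0 := by simpa using hne 0 le_rfl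
  have hzn : ‖z‖ ≠ 0 := by simpa using hz0
  rw [Real.log_mul (pow_ne_zero _ hzn) (pow_ne_zero _ hG0), Real.log_pow] at hmv
  have hlip := norm_digamma_sub_digamma_le (hre u hu.1.le) hz
  have h4 : ‖z + u - z‖ = u := by
    rw [add_sub_cancel_left, Complex.norm_real, Real.norm_eq_abs, abs_of_pos hu.1]
  rw [h4] at hlip
  have h5 := (Complex.re_le_norm _).trans hlip
  rw [Complex.sub_re] at h5
  have := hu.2
  push_cast at hmv
  linarith

lemma norm_mellin_le_of_re_mem_Icc {f : ℝ → ℂ} {a b : ℝ} (ha : MellinConvergent f a)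
    (hb : MellinConvergent f b) : ∃ C, ∀ s : ℂ, a ≤ s.re → s.re ≤ b → ‖mellin f s‖ ≤ C := by
  refine ⟨∫ t in Set.Ioi (0 : ℝ), (‖(t : ℂ) ^ ((a : ℂ) - 1) • f t‖ +
    ‖(t : ℂ) ^ ((b : ℂ) - 1) • f t‖), fun s h1 h2 => ?_⟩
  refine MeasureTheory.norm_integral_le_of_norm_le (ha.norm.add hb.norm) ?_
  refine (MeasureTheory.ae_restrict_iff' measurableSet_Ioi).2 (Eventually.of_forall fun t ht => ?_)
  have ht : 0 < t := ht
  simp only [norm_smul, Complex.norm_cpow_eq_rpow_re_of_pos ht, Complex.sub_re, Complex.ofReal_re,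
    Complex.one_re]
  rw [← add_mul]
  gcongr
  rcases le_total t 1 with h | h
  · have := Real.rpow_le_rpow_of_exponent_ge ht h (sub_le_sub_right h1 1)
    have h3 := Real.rpow_nonneg ht.le (b - 1)
    linarith
  · have := Real.rpow_le_rpow_of_exponent_le h (sub_le_sub_right h2 1)
    have h3 := Real.rpow_nonneg ht.le (a - 1)
    linarith

lemma exists_norm_completedRiemannZeta₀_le (A : ℝ) :
    ∃ C, ∀ s : ℂ, |s.re| ≤ A → ‖completedRiemannZeta₀ s‖ ≤ C := by
  have hconv := fun s => ((HurwitzZeta.hurwitzEvenFEPair 0).isStrongFEPair_toStrongFEPair.hasMellin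
    s).1
  obtain ⟨C, hC⟩ := norm_mellin_le_of_re_mem_Icc (hconv ((-A / 2 : ℝ) : ℂ))
    (hconv ((A / 2 : ℝ) : ℂ))
  refine ⟨C / 2, fun s hs => ?_⟩
  have h := hC (s / 2) (by simp; linarith [(abs_le.1 hs).1]) (by simp; linarith [(abs_le.1 hs).2])
  rw [completedRiemannZeta₀, HurwitzZeta.completedHurwitzZetaEven₀, norm_div]
  simp only [Complex.norm_ofNat]
  gcongr
  exact h

lemma exists_norm_LSeries_le {f : ℕ → ℂ} {σ : ℝ} (hf : LSeriesSummable f σ) :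
    ∃ C, ∀ s : ℂ, σ ≤ s.re → ‖LSeries f s‖ ≤ C := by
  refine ⟨∑' n, ‖LSeries.term f σ n‖, fun s hs => ?_⟩
  exact tsum_of_norm_bounded hf.norm.hasSum fun n =>
    LSeries.norm_term_le_of_re_le_re f (by simpa using hs) n

lemma exists_norm_logDeriv_riemannZeta_le :
    ∃ C, ∀ s : ℂ, 2 ≤ s.re → ‖logDeriv riemannZeta s‖ ≤ C := by
  obtain ⟨C, hC⟩ := exists_norm_LSeries_le (σ := 2)
    (ArithmeticFunction.LSeriesSummable_vonMangoldt (s := (2 : ℝ)) (by simp))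
  refine ⟨C, fun s hs => ?_⟩
  have h := hC s hs
  rw [ArithmeticFunction.LSeries_vonMangoldt_eq_deriv_riemannZeta_div (by linarith), neg_div,
    norm_neg] at h
  exact h

/-- The Riemann xi function, normalised by `ξ(0) = ξ(1) = 1`. -/
noncomputable def riemannXi (s : ℂ) : ℂ := 1 + s * (s - 1) * completedRiemannZeta₀ s

lemma differentiable_riemannXi : Differentiable ℂ riemannXi := by
  have := differentiable_completedZeta₀
  unfold riemannXi
  fun_prop

lemma riemannXi_one_sub (s : ℂ) : riemannXi (1 - s) = riemannXi s := by
  rw [riemannXi, riemannXi, completedRiemannZeta₀_one_sub]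
  ring

lemma riemannXi_eq_mul_completedRiemannZeta {s : ℂ} (h0 : s ≠ 0) (h1 : s ≠ 1) :
    riemannXi s = s * (s - 1) * completedRiemannZeta s := by
  have : 1 - s ≠ 0 := sub_ne_zero.2 h1.symm
  rw [riemannXi, completedRiemannZeta_eq]
  field_simp
  ring

lemma riemannXi_eq {s : ℂ} (h0 : 0 < s.re) (h1 : s ≠ 1) :
    riemannXi s = s * (s - 1) * (s.Gammaℝ * riemannZeta s) := by
  have hs : s ≠ 0 := by rintro rfl; simp at h0
  rw [riemannXi_eq_mul_completedRiemannZeta hs h1, riemannZeta_def_of_ne_zero hs,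
    mul_div_cancel₀ _ (Complex.Gammaℝ_ne_zero_of_re_pos h0)]

lemma riemannXi_one : riemannXi 1 = 1 := by simp [riemannXi]

lemma riemannXi_eq_zero_iff {s : ℂ} (h0 : 0 < s.re) (h1 : s ≠ 1) :
    riemannXi s = 0 ↔ riemannZeta s = 0 := by
  have hs : s ≠ 0 := by rintro rfl; simp at h0
  rw [riemannXi_eq h0 h1]
  simp [hs, sub_ne_zero.2 h1, Complex.Gammaℝ_ne_zero_of_re_pos h0]

lemma Gammaℝ_conj (s : ℂ) :
    (starRingEnd ℂ s).Gammaℝ = starRingEnd ℂ s.Gammaℝ := by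
  have hpi : (Real.pi : ℂ).arg ≠ Real.pi := by
    rw [Complex.arg_ofReal_of_nonneg Real.pi_pos.le]
    exact Real.pi_pos.ne
  have h := Complex.cpow_conj (Real.pi : ℂ) (-s / 2) hpi
  rw [Complex.conj_ofReal] at h
  rw [Complex.Gammaℝ_def, Complex.Gammaℝ_def, map_mul, ← Complex.Gamma_conj, ← h]
  simp [map_ofNat]

lemma riemannXi_conj {s : ℂ} (h0 : 0 < s.re) :
    riemannXi (starRingEnd ℂ s) = starRingEnd ℂ (riemannXi s) := by
  by_cases h1 : s = 1
  · simp [h1, riemannXi_one]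
  have h2 : starRingEnd ℂ s ≠ 1 := fun h => h1 (by simpa using congrArg (starRingEnd ℂ) h)
  rw [riemannXi_eq h0 h1, riemannXi_eq (by simpa using h0) h2, Gammaℝ_conj, riemannZeta_conj]
  simp

lemma norm_riemannXi_reflect {δ : ℝ} (t : ℝ) (hδ : 0 ≤ δ) :
    ‖riemannXi (1 / 2 - δ + t * Complex.I)‖ = ‖riemannXi (1 / 2 + δ + t * Complex.I)‖ := by
  have h1 : (1 / 2 - δ + t * Complex.I : ℂ) =
      1 - starRingEnd ℂ (1 / 2 + δ + t * Complex.I) := by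
    simp [map_ofNat]
    ring
  rw [h1, riemannXi_one_sub, riemannXi_conj (by simp; linarith), Complex.norm_conj]

lemma riemannXi_critical_im (t : ℝ) : (riemannXi (1 / 2 + t * Complex.I)).im = 0 := by
  have h1 : starRingEnd ℂ (1 / 2 + t * Complex.I) = (1 - (1 / 2 + t * Complex.I) : ℂ) := by
    simp [map_ofNat]
    ring
  have h2 := riemannXi_conj (s := 1 / 2 + t * Complex.I) (by simp)
  rw [h1, riemannXi_one_sub] at h2
  exact Complex.conj_eq_iff_im.1 h2.symm

lemma logDeriv_riemannXi_critical_re (t : ℝ) :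
    (logDeriv riemannXi (1 / 2 + t * Complex.I)).re = 0 := by
  set s : ℂ := 1 / 2 + t * Complex.I with hs
  have h1 : HasDerivAt (fun u : ℝ => riemannXi (1 / 2 + u * Complex.I))
      (deriv riemannXi s * Complex.I) t := by
    have h2 : HasDerivAt (fun z : ℂ => riemannXi (1 / 2 + z * Complex.I))
        (deriv riemannXi s * Complex.I) (t : ℂ) := by
      have h3 : HasDerivAt (fun z : ℂ => 1 / 2 + z * Complex.I) Complex.I (t : ℂ) := by
        simpa using ((hasDerivAt_id (t : ℂ)).mul_const Complex.I).const_add (1 / 2)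
      exact HasDerivAt.comp (h₂ := riemannXi) (t : ℂ) (differentiable_riemannXi s).hasDerivAt h3
    exact h2.comp_ofReal
  have h4 : HasDerivAt (fun u : ℝ => (riemannXi (1 / 2 + u * Complex.I)).im)
      (deriv riemannXi s * Complex.I).im t :=
    (Complex.imCLM.hasFDerivAt.comp_hasDerivAt t h1)
  simp only [riemannXi_critical_im] at h4
  have h5 := h4.unique (hasDerivAt_const t (0 : ℝ))
  simp at h5
  rw [logDeriv_apply, Complex.div_re, h5, riemannXi_critical_im]
  simp

lemma riemannXi_ne_zero (RH : RiemannHypothesis) {s : ℂ} (hs : 1 / 2 < s.re) :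
    riemannXi s ≠ 0 := by
  by_cases h1 : s = 1
  · simp [h1, riemannXi_one]
  rw [Ne, riemannXi_eq_zero_iff (by linarith) h1]
  intro h
  have := RH s h (by
    rintro ⟨n, hn⟩
    have h2 := congrArg Complex.re hn
    simp at h2
    have h3 : (0 : ℝ) ≤ n := by positivity
    linarith) h1
  linarith

lemma exists_norm_riemannXi_le {A : ℝ} (hA : 0 ≤ A) :
    ∃ C > 0, ∀ s : ℂ, |s.re| ≤ A → ‖riemannXi s‖ ≤ C * (1 + |s.im|) ^ 2 := by
  obtain ⟨C, hC⟩ := exists_norm_completedRiemannZeta₀_le A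
  refine ⟨1 + (A + 2) ^ 2 * |C|, by positivity, fun s hs => ?_⟩
  have h1 := (hC s hs).trans (le_abs_self C)
  have h2 := Complex.norm_le_abs_re_add_abs_im s
  have h3 : ‖s - 1‖ ≤ ‖s‖ + 1 := by simpa using norm_sub_le s 1
  have h0 := abs_nonneg s.im
  have h4 : ‖s‖ ≤ (A + 2) * (1 + |s.im|) := by nlinarith
  have h5 : ‖s - 1‖ ≤ (A + 2) * (1 + |s.im|) := by nlinarith
  calc ‖riemannXi s‖ ≤ 1 + ‖s‖ * ‖s - 1‖ * ‖completedRiemannZeta₀ s‖ := by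
        rw [riemannXi]
        refine (norm_add_le _ _).trans ?_
        simp
    _ ≤ (1 + |s.im|) ^ 2 +
        ((A + 2) * (1 + |s.im|)) * ((A + 2) * (1 + |s.im|)) * |C| := by
        gcongr
        nlinarith
    _ = _ := by ring

lemma logDeriv_riemannXi_eq {s : ℂ} (hs : 4 ≤ s.re) :
    logDeriv riemannXi s = 1 / s + 1 / (s - 1) - Real.log Real.pi / 2 +
      Complex.digamma (s / 2) / 2 + logDeriv riemannZeta s := by
  have hs0 : s ≠ 0 := by rintro rfl; norm_num at hs
  have hs1 : s ≠ 1 := by rintro rfl; norm_num at hs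
  have hs1' : s - 1 ≠ 0 := sub_ne_zero.2 hs1
  have hre2 : 2 ≤ (s / 2).re := by simp; linarith
  have hGam := differentiableAt_Gamma_of_two_le_re hre2
  have hpi : (Real.pi : ℂ) ≠ 0 := by exact_mod_cast Real.pi_ne_zero
  have hcongr : riemannXi =ᶠ[𝓝 s] fun z => z * (z - 1) *
      ((Complex.exp (-(Real.log Real.pi / 2) * z) * (Complex.Gamma ∘ fun z => z / 2) z) *
        riemannZeta z) := by
    have hopen : {z : ℂ | 1 < z.re} ∈ 𝓝 s :=
      (isOpen_lt continuous_const Complex.continuous_re).mem_nhds (by simp; linarith)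
    filter_upwards [hopen] with z hz
    have hz : 1 < z.re := hz
    rw [riemannXi_eq (by linarith) (by rintro rfl; simp at hz), Complex.Gammaℝ_def,
      Complex.cpow_def_of_ne_zero hpi, ← Complex.ofReal_log Real.pi_pos.le, Function.comp]
    ring_nf
  have hE : DifferentiableAt ℂ (fun z => Complex.exp (-(Real.log Real.pi / 2) * z)) s := by
    fun_prop
  have hhalf : DifferentiableAt ℂ (fun z : ℂ => z / 2) s := by fun_prop
  have hcomp : DifferentiableAt ℂ (Complex.Gamma ∘ fun z => z / 2) s := hGam.comp s hhalf
  have hG0 : (Complex.Gamma ∘ fun z => z / 2) s ≠ 0 :=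
    Complex.Gamma_ne_zero_of_re_pos (by linarith)
  have hz0 : riemannZeta s ≠ 0 := riemannZeta_ne_zero_of_one_le_re (by linarith)
  have hexp : logDeriv (fun z => Complex.exp (-(Real.log Real.pi / 2) * z)) s =
      -(Real.log Real.pi / 2) := by
    have h : HasDerivAt (fun z : ℂ => Complex.exp (-(Real.log Real.pi / 2) * z))
        (Complex.exp (-(Real.log Real.pi / 2) * s) * -(Real.log Real.pi / 2)) s := by
      simpa using ((hasDerivAt_id s).const_mul (-(Real.log Real.pi / 2 : ℂ))).cexp
    rw [logDeriv_apply, h.deriv, mul_comm, mul_div_assoc, div_self (Complex.exp_ne_zero _), mul_one]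
  set E : ℂ → ℂ := fun z => Complex.exp (-(Real.log Real.pi / 2) * z) with hEdef
  set G : ℂ → ℂ := Complex.Gamma ∘ fun z => z / 2 with hGdef
  have hE0 : E s ≠ 0 := Complex.exp_ne_zero _
  rw [(logDeriv_congr_nhds hcongr).eq_of_nhds,
    logDeriv_mul (f := fun z => z * (z - 1)) (g := fun z => E z * G z * riemannZeta z) s
      (mul_ne_zero hs0 hs1') (mul_ne_zero (mul_ne_zero hE0 hG0) hz0) (by fun_prop)
      ((hE.mul hcomp).mul (differentiableAt_riemannZeta hs1)),
    logDeriv_mul (f := fun z => z) (g := fun z => z - 1) s hs0 hs1' (by fun_prop) (by fun_prop),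
    logDeriv_mul (f := fun z => E z * G z) s (mul_ne_zero hE0 hG0) hz0 (hE.mul hcomp)
      (differentiableAt_riemannZeta hs1),
    logDeriv_mul s hE0 hG0 hE hcomp, hexp, hGdef, logDeriv_comp (g := fun z : ℂ => z / 2) hGam hhalf,
    Complex.digamma_def]
  simp [logDeriv_apply]
  ring

lemma exists_log_norm_le_logDeriv_riemannXi_re :
    ∃ C, ∀ s : ℂ, 4 ≤ s.re → Real.log ‖s‖ / 2 - C ≤ (logDeriv riemannXi s).re := by
  obtain ⟨C, hC⟩ := exists_norm_logDeriv_riemannZeta_le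
  refine ⟨C + 2 + Real.log 2 / 2 + Real.log Real.pi / 2 + 1 / 2, fun s hs => ?_⟩
  have hn : 4 ≤ ‖s‖ := hs.trans (Complex.re_le_norm s)
  have hn1 : 3 ≤ ‖s - 1‖ := by
    refine le_trans ?_ (Complex.re_le_norm (s - 1))
    simp; linarith
  have h1 : -1 ≤ (1 / s).re := by
    have h := (abs_le.1 (Complex.abs_re_le_norm (1 / s))).1
    have h2 : ‖1 / s‖ ≤ 1 := by
      rw [norm_div, norm_one, div_le_one (by linarith)]; linarith
    linarith
  have h2 : -1 ≤ (1 / (s - 1)).re := by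
    have h := (abs_le.1 (Complex.abs_re_le_norm (1 / (s - 1)))).1
    have h2 : ‖1 / (s - 1)‖ ≤ 1 := by
      rw [norm_div, norm_one, div_le_one (by linarith)]; linarith
    linarith
  have h3 := log_norm_sub_one_le_digamma_re (z := s / 2) (by simp; linarith)
  have h4 := (abs_le.1 (Complex.abs_re_le_norm (logDeriv riemannZeta s))).1
  have h5 := hC s (by linarith)
  rw [norm_div, Complex.norm_ofNat, Real.log_div (by positivity) (by norm_num)] at h3
  rw [logDeriv_riemannXi_eq hs]
  have h6 : (Complex.digamma (s / 2) / 2).re = (Complex.digamma (s / 2)).re / 2 := by simp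
  have h7 : ((Real.log Real.pi : ℂ) / 2).re = Real.log Real.pi / 2 := by
    rw [← Complex.ofReal_ofNat, ← Complex.ofReal_div, Complex.ofReal_re]
  simp only [Complex.add_re, Complex.sub_re, h6, h7]
  linarith

lemma exists_norm_logDeriv_riemannXi_sub_le :
    ∃ C > 0, ∀ s w : ℂ, 4 ≤ s.re → 4 ≤ w.re →
      ‖logDeriv riemannXi s - logDeriv riemannXi w‖ ≤ C + ‖s - w‖ := by
  obtain ⟨C, hC⟩ := exists_norm_logDeriv_riemannZeta_le
  refine ⟨4 + 2 * |C|, by positivity, fun s w hs hw => ?_⟩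
  have hb : ∀ z : ℂ, 4 ≤ z.re → ‖1 / z + 1 / (z - 1) + logDeriv riemannZeta z‖ ≤ 2 + |C| := by
    intro z hz
    have hn : 4 ≤ ‖z‖ := hz.trans (Complex.re_le_norm z)
    have hn1 : 3 ≤ ‖z - 1‖ := by
      refine le_trans ?_ (Complex.re_le_norm (z - 1))
      simp; linarith
    have h1 : ‖1 / z‖ ≤ 1 := by
      rw [norm_div, norm_one, div_le_one (by linarith)]; linarith
    have h2 : ‖1 / (z - 1)‖ ≤ 1 := by
      rw [norm_div, norm_one, div_le_one (by linarith)]; linarith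
    refine (norm_add₃_le).trans ?_
    linarith [hC z (by linarith), le_abs_self C]
  have hd := norm_digamma_sub_digamma_le (z := s / 2) (w := w / 2) (by simp; linarith)
    (by simp; linarith)
  have hd2 : ‖s / 2 - w / 2‖ = ‖s - w‖ / 2 := by
    rw [← sub_div, norm_div, Complex.norm_ofNat]
  rw [logDeriv_riemannXi_eq hs, logDeriv_riemannXi_eq hw]
  have heq : 1 / s + 1 / (s - 1) - Real.log Real.pi / 2 +
      Complex.digamma (s / 2) / 2 + logDeriv riemannZeta s -
      (1 / w + 1 / (w - 1) - Real.log Real.pi / 2 +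
      Complex.digamma (w / 2) / 2 + logDeriv riemannZeta w) =
      (1 / s + 1 / (s - 1) + logDeriv riemannZeta s) -
      (1 / w + 1 / (w - 1) + logDeriv riemannZeta w) +
      (Complex.digamma (s / 2) - Complex.digamma (w / 2)) / 2 := by ring
  rw [heq]
  refine (norm_add_le _ _).trans ((add_le_add_left (norm_sub_le _ _) _).trans ?_)
  rw [norm_div, Complex.norm_ofNat]
  have := norm_nonneg (s - w)
  linarith [hb s hs, hb w hw]

lemma exists_norm_logDeriv_riemannXi_le {a : ℝ} (ha : 4 ≤ a) :
    ∃ C > 0, ∀ t : ℝ, ‖logDeriv riemannXi (a + t * Complex.I)‖ ≤ C * (1 + |t|) := by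
  obtain ⟨C, hC0, hC⟩ := exists_norm_logDeriv_riemannXi_sub_le
  refine ⟨C + 1 + ‖logDeriv riemannXi a‖, by positivity, fun t => ?_⟩
  have h := hC (a + t * Complex.I) a (by simpa using ha) (by simpa using ha)
  have h1 : ‖(a + t * Complex.I : ℂ) - a‖ = |t| := by simp
  have h2 := norm_sub_norm_le (logDeriv riemannXi (a + t * Complex.I)) (logDeriv riemannXi a)
  rw [h1] at h
  have := abs_nonneg t
  nlinarith [norm_nonneg (logDeriv riemannXi a)]

lemma riemannXi_ne_zero_of_one_lt_re {s : ℂ} (hs : 1 < s.re) : riemannXi s ≠ 0 := by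
  rw [Ne, riemannXi_eq_zero_iff (by linarith) (by rintro rfl; simp at hs)]
  exact riemannZeta_ne_zero_of_one_le_re hs.le

lemma exists_exp_neg_le_norm_riemannXi_line {a : ℝ} (ha : 4 ≤ a) :
    ∃ C > 0, ∀ t : ℝ, Real.exp (-(C * (1 + |t|) ^ 2)) ≤ ‖riemannXi (a + t * Complex.I)‖ := by
  obtain ⟨C, hC0, hC⟩ := exists_norm_logDeriv_riemannXi_le ha
  have hne : ∀ t : ℝ, riemannXi (a + t * Complex.I) ≠ 0 := fun t =>
    riemannXi_ne_zero_of_one_lt_re (by simp; linarith)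
  set g : ℂ → ℂ := fun z => riemannXi (a + z * Complex.I) with hg
  have hgd : ∀ z, HasDerivAt g (deriv riemannXi (a + z * Complex.I) * Complex.I) z := fun z =>
    HasDerivAt.comp (h₂ := riemannXi) z (differentiable_riemannXi _).hasDerivAt
      (by simpa using ((hasDerivAt_id z).mul_const Complex.I).const_add (a : ℂ))
  have hlog : ∀ u : ℝ, HasDerivAt (fun t : ℝ => Real.log (‖g (0 + t)‖ ^ 2))
      (2 * (logDeriv g (0 + u)).re) u := fun u =>
    hasDerivAt_log_norm_sq_comp_add_ofReal (hgd _).differentiableAt (by simpa [hg] using hne u)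
  have hlogD : ∀ u : ℝ, logDeriv g (0 + u) =
      logDeriv riemannXi (a + u * Complex.I) * Complex.I := fun u => by
    rw [zero_add, logDeriv_apply, (hgd u).deriv, logDeriv_apply]
    ring
  have hbound : ∀ t : ℝ, -(2 * C * (1 + |t|) * |t|) ≤
      Real.log (‖g t‖ ^ 2) - Real.log (‖g 0‖ ^ 2) := by
    intro t
    have hmv := Convex.norm_image_sub_le_of_norm_hasDerivWithin_le
      (f := fun t : ℝ => Real.log (‖g (0 + t)‖ ^ 2)) (s := Set.Icc (-|t|) |t|)
      (C := 2 * C * (1 + |t|)) (x := 0) (y := t)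
      (fun u _ => (hlog u).hasDerivWithinAt) (fun u hu => ?_) (convex_Icc _ _)
      (by simp) ⟨neg_abs_le t, le_abs_self t⟩
    · simp only [zero_add, Complex.ofReal_zero, Real.norm_eq_abs, sub_zero] at hmv
      linarith [(abs_le.1 hmv).1]
    · have hu' : |u| ≤ |t| := abs_le.2 hu
      rw [norm_mul, hlogD]
      have h1 := Complex.abs_re_le_norm (logDeriv riemannXi (a + u * Complex.I) * Complex.I)
      rw [norm_mul, Complex.norm_I, mul_one] at h1
      have h2 := hC u
      have h3 : C * (1 + |u|) ≤ C * (1 + |t|) := by gcongr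
      simp only [Real.norm_eq_abs, Nat.abs_ofNat]
      linarith
  refine ⟨C + |Real.log ‖g 0‖|, by positivity, fun t => ?_⟩
  have hpos : 0 < ‖riemannXi (a + t * Complex.I)‖ := norm_pos_iff.2 (hne t)
  rw [← Real.le_log_iff_exp_le hpos]
  have h := hbound t
  rw [Real.log_pow, Real.log_pow] at h
  push_cast at h
  have h1 : g t = riemannXi (a + t * Complex.I) := rfl
  rw [h1] at h
  have h2 := neg_abs_le (Real.log ‖g 0‖)
  have h3 := abs_nonneg t
  have h4 := abs_nonneg (Real.log ‖g 0‖)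
  nlinarith [mul_nonneg hC0.le h3, mul_nonneg h4 h3, mul_nonneg (mul_nonneg h4 h3) h3]

lemma exists_exp_neg_le_norm_riemannXi (RH : RiemannHypothesis) {δ a : ℝ} (hδ : 0 < δ)
    (ha : 4 ≤ a) : ∃ C > 0, ∀ s : ℂ, 1 / 2 + δ ≤ s.re → s.re ≤ a →
      Real.exp (-(C * (1 + |s.im|) ^ 2)) ≤ ‖riemannXi s‖ := by
  obtain ⟨C₁, hC₁0, hC₁⟩ := exists_exp_neg_le_norm_riemannXi_line ha
  obtain ⟨C₂, hC₂0, hC₂⟩ := exists_norm_riemannXi_le (A := 2 * a) (by linarith)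
  set K : ℝ := |Real.log C₂| + 2 * (1 + a) + C₁ + 1 with hK
  have hK0 : 0 < K := by positivity
  refine ⟨C₁ + 2 * K * a / δ, by positivity, fun s hs1 hs2 => ?_⟩
  set c : ℂ := a + s.im * Complex.I with hc
  set x : ℝ := 1 + |s.im| with hx
  have hx1 : 1 ≤ x := by linarith [abs_nonneg s.im]
  have hball : ∀ z ∈ Metric.ball c (a - 1 / 2), 1 / 2 < z.re ∧ z.re < 2 * a ∧
      |z.im| ≤ |s.im| + a := by
    intro z hz
    rw [Metric.mem_ball, dist_eq_norm] at hz
    have h1 := abs_le.1 (Complex.abs_re_le_norm (z - c))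
    have h2 := Complex.abs_im_le_norm (z - c)
    simp [hc] at h1 h2
    have h3 := abs_sub_abs_le_abs_sub z.im s.im
    refine ⟨by linarith, by linarith, by linarith⟩
  have hM : ∀ z ∈ Metric.ball c (a - 1 / 2), ‖riemannXi z‖ ≤ C₂ * ((1 + a) * x) ^ 2 := by
    intro z hz
    obtain ⟨h1, h2, h3⟩ := hball z hz
    refine (hC₂ z (abs_le.2 ⟨by linarith, h2.le⟩)).trans ?_
    gcongr
    nlinarith [abs_nonneg s.im]
  have hsc : ‖s - c‖ = a - s.re := by
    have : s - c = ((s.re - a : ℝ) : ℂ) := by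
      apply Complex.ext <;> simp [hc]
    rw [this, Complex.norm_real, Real.norm_eq_abs, abs_of_nonpos (by linarith)]
    ring
  have hsmem : s ∈ Metric.ball c (a - 1 / 2) := by
    rw [Metric.mem_ball, dist_eq_norm, hsc]; linarith
  have key := norm_lower_bound_of_ne_zero_on_ball (f := riemannXi) (c := c)
    (R := a - 1 / 2) (M := C₂ * ((1 + a) * x) ^ 2) (by linarith)
    differentiable_riemannXi.differentiableOn
    (fun z hz => riemannXi_ne_zero RH (hball z hz).1) hM hsmem
  rw [hsc] at key
  have hline := hC₁ s.im
  rw [← hc] at hline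
  have hpos : 0 < ‖riemannXi c‖ := (Real.exp_pos _).trans_le hline
  have hlogline : -(C₁ * x ^ 2) ≤ Real.log ‖riemannXi c‖ := by
    rwa [Real.le_log_iff_exp_le hpos]
  have hlogM : Real.log (C₂ * ((1 + a) * x) ^ 2 / ‖riemannXi c‖) + 1 ≤ K * x ^ 2 := by
    rw [Real.log_div (by positivity) hpos.ne', Real.log_mul hC₂0.ne' (by positivity),
      Real.log_pow]
    have h1 := le_abs_self (Real.log C₂)
    have h2 := Real.log_le_sub_one_of_pos (show 0 < (1 + a) * x by positivity)
    have h3 : 1 ≤ x ^ 2 := by nlinarith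
    have h4 : x ≤ x ^ 2 := by nlinarith
    have h5 : |Real.log C₂| ≤ |Real.log C₂| * x ^ 2 := by nlinarith [abs_nonneg (Real.log C₂)]
    have h6 : (1 + a) * x ≤ (1 + a) * x ^ 2 := by gcongr
    push_cast
    rw [hK]
    nlinarith
  refine le_trans ?_ key
  have hexp : 2 * (Real.log (C₂ * ((1 + a) * x) ^ 2 / ‖riemannXi c‖) + 1) * (a - s.re) /
      (a - 1 / 2 - (a - s.re)) ≤ 2 * K * a / δ * x ^ 2 := by
    have h1 : 2 * (Real.log (C₂ * ((1 + a) * x) ^ 2 / ‖riemannXi c‖) + 1) * (a - s.re) ≤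
        2 * (K * x ^ 2) * a := by
      refine (mul_le_mul_of_nonneg_right (mul_le_mul_of_nonneg_left hlogM zero_le_two)
        (by linarith)).trans ?_
      refine mul_le_mul_of_nonneg_left (by linarith) (by positivity)
    calc _ ≤ 2 * (K * x ^ 2) * a / δ := by
          refine div_le_div₀ (by positivity) h1 hδ (by linarith)
      _ = _ := by ring
  calc Real.exp (-((C₁ + 2 * K * a / δ) * x ^ 2))
      = Real.exp (-(C₁ * x ^ 2)) * Real.exp (-(2 * K * a / δ * x ^ 2)) := by
        rw [← Real.exp_add]; ring_nf
    _ ≤ _ := by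
        gcongr

/-- To the right of a suitable vertical line, the logarithmic derivative of `ξ` has nonnegative
real part. -/
lemma exists_logDeriv_riemannXi_re_nonneg :
    ∃ N : ℝ, 5 ≤ N ∧ ∀ s : ℂ, N - 1 ≤ s.re → 0 ≤ (logDeriv riemannXi s).re := by
  obtain ⟨C, hC⟩ := exists_log_norm_le_logDeriv_riemannXi_re
  refine ⟨max 5 (Real.exp (2 * C) + 1), le_max_left _ _, fun s hs => ?_⟩
  have h1 : 4 ≤ s.re := by linarith [le_max_left 5 (Real.exp (2 * C) + 1)]
  have h2 : Real.exp (2 * C) ≤ s.re := by linarith [le_max_right 5 (Real.exp (2 * C) + 1)]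
  have h3 : Real.exp (2 * C) ≤ ‖s‖ := h2.trans (Complex.re_le_norm s)
  have h4 := (Real.le_log_iff_exp_le ((Real.exp_pos _).trans_le h3)).2 h3
  linarith [hC s h1]

lemma isBigO_exp_exp_of_norm_le {f : ℂ → ℂ} {l : Filter ℂ} {C c : ℝ} (hc : 0 < c)
    (hC : 0 ≤ C) (h : ∀ᶠ s in l, ‖f s‖ ≤ Real.exp (C * (1 + |s.im|) ^ 2)) :
    f =O[l] fun z => Real.exp ((C * (2 + 2 * (1 + 2 / c ^ 2))) * Real.exp (c * |z.im|)) := by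
  refine Asymptotics.IsBigO.of_bound 1 (h.mono fun s hs => hs.trans ?_)
  rw [one_mul, Real.norm_eq_abs, Real.abs_exp]
  refine Real.exp_le_exp.2 ?_
  rw [mul_assoc]
  refine mul_le_mul_of_nonneg_left ?_ hC
  have hy := abs_nonneg s.im
  set y := |s.im|
  have h1 := Real.quadratic_le_exp_of_nonneg (x := c * y) (by positivity)
  have h2 : 1 ≤ Real.exp (c * y) := Real.one_le_exp (by positivity)
  have h3 : y ^ 2 ≤ 2 / c ^ 2 * Real.exp (c * y) := by
    rw [div_mul_eq_mul_div, le_div_iff₀ (by positivity)]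
    nlinarith [mul_nonneg hc.le hy]
  nlinarith [sq_nonneg (y - 1)]

lemma norm_riemannXi_sub_le_add_of_re_eq {N δ : ℝ} (hN5 : 5 ≤ N)
    (hN : ∀ s : ℂ, N - 1 ≤ s.re → 0 ≤ (logDeriv riemannXi s).re) (hδ : 0 < δ) (hδ1 : δ < 1)
    {s : ℂ} (hs : s.re = N) : ‖riemannXi (s - δ)‖ ≤ ‖riemannXi (s + δ)‖ := by
  have hne : ∀ u ∈ Set.Icc (-δ) δ, riemannXi (s + (u : ℝ)) ≠ 0 := fun u hu =>
    riemannXi_ne_zero_of_one_lt_re (by simp [hs]; linarith [hu.1])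
  have hd : ∀ u ∈ Set.Icc (-δ) δ, HasDerivAt (fun a : ℝ => Real.log (‖riemannXi (s + a)‖ ^ 2))
      (2 * (logDeriv riemannXi (s + u)).re) u := fun u hu =>
    hasDerivAt_log_norm_sq_comp_add_ofReal (differentiable_riemannXi _) (hne u hu)
  have hmono : MonotoneOn (fun a : ℝ => Real.log (‖riemannXi (s + a)‖ ^ 2)) (Set.Icc (-δ) δ) := by
    refine monotoneOn_of_deriv_nonneg (convex_Icc _ _)
      (fun u hu => (hd u hu).continuousAt.continuousWithinAt)
      (fun u hu => (hd u (interior_subset hu)).differentiableAt.differentiableWithinAt)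
      fun u hu => ?_
    have hu := interior_subset hu
    rw [(hd u hu).deriv]
    have := hN (s + u) (by simp [hs]; linarith [hu.1])
    linarith
  have hl : -δ ∈ Set.Icc (-δ) δ := ⟨le_rfl, by linarith⟩
  have hr : δ ∈ Set.Icc (-δ) δ := ⟨by linarith, le_rfl⟩
  have h := hmono hl hr (by linarith)
  have h1 := hne _ hl
  have h2 := hne _ hr
  have h3 := (Real.log_le_log_iff (by positivity) (by positivity)).1 h
  have h4 := (pow_le_pow_iff_left₀ (norm_nonneg _) (norm_nonneg _) two_ne_zero).1 h3
  simpa [sub_eq_add_neg] using h4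

lemma norm_riemannXi_sub_le_add (RH : RiemannHypothesis) {N δ : ℝ} (hN5 : 5 ≤ N)
    (hN : ∀ s : ℂ, N - 1 ≤ s.re → 0 ≤ (logDeriv riemannXi s).re) (hδ : 0 < δ) (hδ1 : δ < 1)
    {s : ℂ} (hs1 : 1 / 2 ≤ s.re) (hs2 : s.re ≤ N) :
    ‖riemannXi (s - δ)‖ ≤ ‖riemannXi (s + δ)‖ := by
  have hne : ∀ z : ℂ, 1 / 2 ≤ z.re → riemannXi (z + δ) ≠ 0 := fun z hz =>
    riemannXi_ne_zero RH (by simp; linarith)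
  set Q : ℂ → ℂ := fun z => riemannXi (z - δ) / riemannXi (z + δ) with hQ
  have hQd : ∀ z : ℂ, 1 / 2 ≤ z.re → DifferentiableAt ℂ Q z := by
    intro z hz
    have h1 : DifferentiableAt ℂ (fun z => riemannXi (z - δ)) z :=
      (differentiable_riemannXi.comp (differentiable_id.sub_const (δ : ℂ))) z
    have h2 : DifferentiableAt ℂ (fun z => riemannXi (z + δ)) z :=
      (differentiable_riemannXi.comp (differentiable_id.add_const (δ : ℂ))) z
    exact h1.div h2 (hne z hz)
  obtain ⟨C₁, hC₁0, hC₁⟩ := exists_exp_neg_le_norm_riemannXi RH hδ (a := N + 1) (by linarith)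
  obtain ⟨C₂, hC₂0, hC₂⟩ := exists_norm_riemannXi_le (A := N + 1) (by linarith)
  have hbound : ∀ z : ℂ, 1 / 2 ≤ z.re → z.re ≤ N →
      ‖Q z‖ ≤ Real.exp ((C₂ + 1 + C₁) * (1 + |z.im|) ^ 2) := by
    intro z h1 h2
    have hlow := hC₁ (z + δ) (by simp; linarith) (by simp; linarith)
    have hup := hC₂ (z - δ) (abs_le.2 ⟨by simp; linarith, by simp; linarith⟩)
    simp only [Complex.add_im, Complex.sub_im, Complex.ofReal_im, add_zero, sub_zero] at hlow hup
    rw [hQ]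
    simp only [norm_div]
    rw [div_le_iff₀ (norm_pos_iff.2 (hne z h1))]
    set x := (1 + |z.im|) ^ 2
    calc ‖riemannXi (z - δ)‖ ≤ C₂ * x := hup
      _ ≤ Real.exp ((C₂ + 1) * x) := by
          have hx : 0 ≤ x := by positivity
          nlinarith [Real.add_one_le_exp ((C₂ + 1) * x)]
      _ = Real.exp ((C₂ + 1 + C₁) * x) * Real.exp (-(C₁ * x)) := by
          rw [← Real.exp_add]; ring_nf
      _ ≤ _ := by gcongr
  have hcl : closure (Complex.re ⁻¹' Set.Ioo (1 / 2) N) = Complex.re ⁻¹' Set.Icc (1 / 2) N := by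
    rw [← closure_Ioo (by linarith : (1 / 2 : ℝ) ≠ N), Complex.closure_preimage_re]
  have hmain : ‖Q s‖ ≤ 1 := by
    refine PhragmenLindelof.vertical_strip (a := 1 / 2) (b := N) ?_ ?_ ?_ ?_ hs1 hs2
    · refine DifferentiableOn.diffContOnCl fun z hz => ?_
      rw [hcl] at hz
      exact (hQd z hz.1).differentiableWithinAt
    · have hpos : 0 < Real.pi / (N - 1 / 2) := div_pos Real.pi_pos (by linarith)
      refine ⟨Real.pi / (N - 1 / 2) / 2, by linarith, _,
        isBigO_exp_exp_of_norm_le (C := C₂ + 1 + C₁) (by linarith) (by linarith) ?_⟩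
      refine Filter.Eventually.filter_mono inf_le_right ?_
      exact eventually_principal.2 fun z hz => hbound z hz.1.le hz.2.le
    · intro z hz
      have hzeq : z = 1 / 2 + z.im * Complex.I := by
        apply Complex.ext <;> simp [hz]
      have h := norm_riemannXi_reflect z.im hδ.le
      rw [hQ]
      simp only [norm_div]
      rw [div_le_one (norm_pos_iff.2 (hne z hz.ge))]
      have e1 : z - δ = 1 / 2 - δ + z.im * Complex.I := by
        rw [sub_add_eq_add_sub, ← hzeq]
      have e2 : z + δ = 1 / 2 + δ + z.im * Complex.I := by
        rw [add_right_comm, ← hzeq]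
      rw [e1, e2, h]
    · intro z hz
      rw [hQ]
      simp only [norm_div]
      rw [div_le_one (norm_pos_iff.2 (hne z (by linarith)))]
      exact norm_riemannXi_sub_le_add_of_re_eq hN5 hN hδ hδ1 hz
  rw [hQ] at hmain
  simp only [norm_div] at hmain
  rwa [div_le_one (norm_pos_iff.2 (hne s hs1))] at hmain

/-- Under the Riemann hypothesis, `Re (logDeriv ξ) ≥ 0` to the right of the critical line. -/
lemma logDeriv_riemannXi_re_nonneg (RH : RiemannHypothesis) {s : ℂ} (hs : 1 / 2 < s.re) :
    0 ≤ (logDeriv riemannXi s).re := by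
  obtain ⟨N, hN5, hN⟩ := exists_logDeriv_riemannXi_re_nonneg
  rcases le_total (N - 1) s.re with h | h
  · exact hN s h
  have hne : riemannXi s ≠ 0 := riemannXi_ne_zero RH hs
  set φ : ℝ → ℝ := fun a => Real.log (‖riemannXi (s + a)‖ ^ 2) with hφ
  have hd : HasDerivAt φ (2 * (logDeriv riemannXi s).re) 0 := by
    have := hasDerivAt_log_norm_sq_comp_add_ofReal (f := riemannXi) (z := s) (u := 0)
      (differentiable_riemannXi _) (by simpa using hne)
    simpa only [Complex.ofReal_zero, add_zero] using this
  have hd' : HasDerivAt (fun a => φ a - φ (-a)) (4 * (logDeriv riemannXi s).re) 0 := by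
    have h2 : HasDerivAt (fun a : ℝ => φ (-a)) (-(2 * (logDeriv riemannXi s).re)) 0 := by
      have := HasDerivAt.comp (h₂ := φ) (h := fun a : ℝ => -a) 0 (by simpa using hd)
        (hasDerivAt_neg' (0 : ℝ))
      simpa [Function.comp_def] using this
    refine (hd.sub h2).congr_deriv (by ring)
  have ht := (hasDerivAt_iff_tendsto_slope_zero.1 hd').mono_left
    (nhdsWithin_mono (0 : ℝ) (s := Set.Ioi 0) (fun x hx => ne_of_gt hx))
  have hev : ∀ᶠ a : ℝ in 𝓝[>] 0, 0 ≤ a⁻¹ • ((φ (0 + a) - φ (-(0 + a))) - (φ 0 - φ (-0))) := by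
    have hlt : ∀ᶠ a : ℝ in 𝓝[>] 0, a < min 1 (s.re - 1 / 2) :=
      eventually_nhdsWithin_of_eventually_nhds (eventually_lt_nhds (by simp; linarith))
    filter_upwards [self_mem_nhdsWithin, hlt] with a ha ha1
    have ha : 0 < a := ha
    have h1 := norm_riemannXi_sub_le_add RH hN5 hN ha (ha1.trans_le (min_le_left _ _)) hs.le
      (by linarith)
    have h2 : riemannXi (s - a) ≠ 0 := riemannXi_ne_zero RH (by
      simp; linarith [ha1.trans_le (min_le_right _ _)])
    have h3 : φ (-a) ≤ φ a := by
      simp only [hφ, Complex.ofReal_neg, ← sub_eq_add_neg]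
      exact Real.log_le_log (by positivity) (by gcongr)
    simp only [zero_add, neg_zero, sub_self, sub_zero, smul_eq_mul]
    exact mul_nonneg (by positivity) (by linarith)
  have := ge_of_tendsto ht hev
  linarith

lemma exists_norm_logDeriv_riemannXi_le_strip (RH : RiemannHypothesis) {ε N : ℝ} (hε : 0 < ε)
    (hN : 4 ≤ N) : ∃ C > 0, ∀ s : ℂ, 1 / 2 + ε ≤ s.re → s.re ≤ N →
      ‖logDeriv riemannXi s‖ ≤ C * (1 + |s.im|) := by
  obtain ⟨C, hC0, hC⟩ := exists_norm_logDeriv_riemannXi_le hN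
  refine ⟨(2 + 2 * C) * N / ε, by positivity, fun s h1 h2 => ?_⟩
  have hdiff : DifferentiableOn ℂ (logDeriv riemannXi) {s | 1 / 2 < s.re} := by
    intro z hz
    have h3 : DifferentiableAt ℂ (deriv riemannXi) z :=
      differentiable_riemannXi.deriv z
    exact (h3.div (differentiable_riemannXi z) (riemannXi_ne_zero RH hz)).differentiableWithinAt
  have h := norm_le_of_re_nonneg_on_half_plane hdiff
    (fun z hz => logDeriv_riemannXi_re_nonneg RH hz) (s := s) (β := N) (by linarith) h2
  refine h.trans ?_
  have h3 := hC s.im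
  have h4 := abs_nonneg s.im
  calc _ ≤ ((2 + 2 * C) * (1 + |s.im|)) * N / ε := by
        refine div_le_div₀ (by positivity) (mul_le_mul (by nlinarith) (by linarith) (by linarith)
          (by positivity)) hε (by linarith)
    _ = _ := by ring

lemma Complex.norm_sin_le (w : ℂ) : ‖Complex.sin w‖ ≤ Real.exp |w.im| := by
  have h1 : ‖Complex.exp (-w * Complex.I)‖ ≤ Real.exp |w.im| := by
    rw [Complex.norm_exp]
    simpa using le_abs_self w.im
  have h2 : ‖Complex.exp (w * Complex.I)‖ ≤ Real.exp |w.im| := by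
    rw [Complex.norm_exp]
    simpa using neg_le_abs w.im
  rw [Complex.sin, norm_div, norm_mul, Complex.norm_I, mul_one, Complex.norm_ofNat]
  linarith [norm_sub_le (Complex.exp (-w * Complex.I)) (Complex.exp (w * Complex.I))]

/-- An entire extension of `sinc`. -/
lemma exists_entire_sinc : ∃ S : ℂ → ℂ, Differentiable ℂ S ∧ (∀ x : ℝ, S x = Real.sinc x) ∧
    ∃ C > 0, ∀ w, ‖S w‖ ≤ C * Real.exp |w.im| / (1 + ‖w‖) := by
  have hd : Differentiable ℂ (dslope Complex.sin 0) := by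
    rw [← differentiableOn_univ, Complex.differentiableOn_dslope Filter.univ_mem]
    exact Complex.differentiable_sin.differentiableOn
  refine ⟨dslope Complex.sin 0, hd, fun x => ?_, ?_⟩
  · by_cases hx : x = 0
    · simp [hx, Complex.deriv_sin]
    · have hx' : (x : ℂ) ≠ 0 := by exact_mod_cast hx
      rw [dslope_of_ne _ hx', Real.sinc_of_ne_zero hx, slope_def_field]
      simp
  · obtain ⟨K, hK⟩ := (isCompact_closedBall (0 : ℂ) 1).exists_bound_of_continuousOn
      hd.continuous.continuousOn
    refine ⟨2 + 2 * |K|, by positivity, fun w => ?_⟩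
    have he : 1 ≤ Real.exp |w.im| := Real.one_le_exp (abs_nonneg _)
    have hw0 := norm_nonneg w
    rw [le_div_iff₀ (by positivity)]
    rcases le_total ‖w‖ 1 with h | h
    · have h1 := (hK w (by simpa using h)).trans (le_abs_self K)
      calc _ ≤ |K| * (1 + 1) := by gcongr
        _ ≤ (2 + 2 * |K|) * 1 := by linarith [abs_nonneg K]
        _ ≤ _ := by gcongr
    · have hw : w ≠ 0 := by rintro rfl; norm_num at h
      rw [dslope_of_ne _ hw, slope_def_field, norm_div]
      simp only [Complex.sin_zero, sub_zero]
      rw [div_mul_eq_mul_div, div_le_iff₀ (by positivity)]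
      have h1 := Complex.norm_sin_le w
      calc ‖Complex.sin w‖ * (1 + ‖w‖) ≤ Real.exp |w.im| * (2 * ‖w‖) := by gcongr; linarith
        _ ≤ _ := by
          have : 0 ≤ |K| * Real.exp |w.im| * ‖w‖ := by positivity
          nlinarith

/-- An entire function of exponential type, real on the real axis, nonpositive outside a bounded
interval, with positive integral. -/
lemma exists_kernel : ∃ (k : ℂ → ℂ) (A C : ℝ), 0 < A ∧ 0 < C ∧ Differentiable ℂ k ∧
    (∀ w, ‖k w‖ ≤ C * Real.exp (6 * |w.im|) / (1 + ‖w‖) ^ 4) ∧ (∀ x : ℝ, (k x).im = 0) ∧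
    (∀ x : ℝ, A ≤ |x| → (k x).re ≤ 0) ∧ 0 < ∫ x : ℝ, (k x).re := by
  obtain ⟨S, hSd, hSx, K, hK0, hK⟩ := exists_entire_sinc
  have hsinc : ∀ x : ℝ, |Real.sinc x| ≤ K / (1 + |x|) := by
    intro x
    have := hK x
    rw [hSx] at this
    simpa using this
  have hinteg : ∀ j ≤ 2, MeasureTheory.Integrable fun x : ℝ => x ^ j * Real.sinc x ^ 6 := by
    intro j hj
    refine MeasureTheory.Integrable.mono' (g := fun x : ℝ => K ^ 6 * (1 + x ^ 2)⁻¹)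
      (integrable_inv_one_add_sq.const_mul _)
      (Continuous.aestronglyMeasurable (by have := Real.continuous_sinc; fun_prop))
      (Eventually.of_forall fun x => ?_)
    have hx := abs_nonneg x
    rw [norm_mul, norm_pow, norm_pow, Real.norm_eq_abs, Real.norm_eq_abs]
    calc |x| ^ j * |Real.sinc x| ^ 6 ≤ (1 + |x|) ^ 2 * (K / (1 + |x|)) ^ 6 := by
          gcongr
          · calc |x| ^ j ≤ (1 + |x|) ^ j := by gcongr; linarith
              _ ≤ _ := pow_le_pow_right₀ (by linarith) hj
          · exact hsinc x
      _ = K ^ 6 * ((1 + |x|) ^ 4)⁻¹ := by field_simp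
      _ ≤ _ := by
          gcongr
          rw [← sq_abs x]
          nlinarith [mul_nonneg hx hx, mul_nonneg (mul_nonneg hx hx) hx]
  have hI0 : 0 < ∫ x : ℝ, Real.sinc x ^ 6 := by
    refine MeasureTheory.integral_pos_of_integrable_nonneg_nonzero (x := 0)
      (Real.continuous_sinc.pow 6) (by simpa using hinteg 0 (by norm_num))
      (fun x => by positivity) (by simp)
  set I0 := ∫ x : ℝ, Real.sinc x ^ 6 with hI0def
  set I2 := ∫ x : ℝ, x ^ 2 * Real.sinc x ^ 6 with hI2def
  have hI2 : 0 ≤ I2 := MeasureTheory.integral_nonneg fun x => by positivity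
  set A := Real.sqrt ((I2 + 1) / I0) with hA
  have hApos : 0 < A := Real.sqrt_pos.2 (by positivity)
  have hA2 : A ^ 2 = (I2 + 1) / I0 := Real.sq_sqrt (by positivity)
  have hreal : ∀ x : ℝ, ((A : ℂ) ^ 2 - (x : ℂ) ^ 2) * S x ^ 6 =
      ((A ^ 2 * Real.sinc x ^ 6 - x ^ 2 * Real.sinc x ^ 6 : ℝ) : ℂ) := by
    intro x
    rw [hSx]
    push_cast
    ring
  refine ⟨fun z => ((A : ℂ) ^ 2 - z ^ 2) * S z ^ 6, A, (A ^ 2 + 1) * K ^ 6, hApos, by positivity,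
    by fun_prop, fun w => ?_, fun x => ?_, fun x hx => ?_, ?_⟩
  · have hw := norm_nonneg w
    have h1 : ‖(A : ℂ) ^ 2 - w ^ 2‖ ≤ (A ^ 2 + 1) * (1 + ‖w‖) ^ 2 := by
      refine (norm_sub_le _ _).trans ?_
      rw [norm_pow, norm_pow, Complex.norm_real, Real.norm_eq_abs, sq_abs]
      nlinarith [mul_nonneg (sq_nonneg A) hw, mul_nonneg (sq_nonneg A) (mul_nonneg hw hw)]
    rw [norm_mul, norm_pow (S w)]
    calc _ ≤ ((A ^ 2 + 1) * (1 + ‖w‖) ^ 2) * (K * Real.exp |w.im| / (1 + ‖w‖)) ^ 6 := by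
          gcongr
          exact hK w
      _ = _ := by
          rw [div_pow, mul_pow, ← Real.exp_nat_mul]
          push_cast
          field_simp
  · simp only [hreal, Complex.ofReal_im]
  · simp only [hreal, Complex.ofReal_re]
    have h1 : A ^ 2 ≤ x ^ 2 := by rw [← sq_abs x]; gcongr
    have h2 : 0 ≤ Real.sinc x ^ 6 := by positivity
    nlinarith
  · simp only [hreal, Complex.ofReal_re]
    have h0 : MeasureTheory.Integrable fun x : ℝ => Real.sinc x ^ 6 := by
      simpa using hinteg 0 (by norm_num)
    rw [MeasureTheory.integral_sub (h0.const_mul (A ^ 2)) (hinteg 2 le_rfl),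
      MeasureTheory.integral_const_mul, hA2, ← hI0def, ← hI2def, div_mul_cancel₀ _ hI0.ne']
    linarith

lemma exists_logDeriv_riemannXi_re_le_one {K : Set ℝ} (hK : IsCompact K)
    (h0 : ∀ t ∈ K, riemannXi (1 / 2 + t * Complex.I) ≠ 0) :
    ∃ ε : ℝ, 0 < ε ∧ ε ≤ 1 ∧ ∀ t ∈ K,
      (logDeriv riemannXi (((1 / 2 + ε : ℝ) : ℂ) + t * Complex.I)).re ≤ 1 := by
  have hev : ∀ᶠ ε : ℝ in 𝓝 0, ∀ t ∈ K,
      (logDeriv riemannXi (((1 / 2 + ε : ℝ) : ℂ) + t * Complex.I)).re ≤ 1 := by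
    refine hK.eventually_forall_of_forall_eventually
      (P := fun ε t => (logDeriv riemannXi (((1 / 2 + ε : ℝ) : ℂ) + t * Complex.I)).re ≤ 1)
      fun t ht => ?_
    have hc : ContinuousAt (logDeriv riemannXi) (1 / 2 + t * Complex.I) :=
      (differentiable_riemannXi.deriv _).continuousAt.div
        (differentiable_riemannXi _).continuousAt (h0 t ht)
    have hcont : ContinuousAt (fun z : ℝ × ℝ =>
        (logDeriv riemannXi (((1 / 2 + z.1 : ℝ) : ℂ) + z.2 * Complex.I)).re) (0, t) := by
      refine Complex.continuous_re.continuousAt.comp ?_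
      refine ContinuousAt.comp (g := logDeriv riemannXi)
        (f := fun z : ℝ × ℝ => (((1 / 2 + z.1 : ℝ) : ℂ) + z.2 * Complex.I)) (by simpa using hc) ?_
      fun_prop
    refine (ContinuousAt.eventually_lt hcont (continuousAt_const (y := 1)) ?_).mono
      fun z hz => hz.le
    have := logDeriv_riemannXi_critical_re t
    simp only [add_zero]
    push_cast
    rw [this]
    exact zero_lt_one
  obtain ⟨ε, hε1, hε2, hε3⟩ := ((eventually_nhdsWithin_of_eventually_nhds hev).and
    ((eventually_nhdsWithin_of_eventually_nhds (eventually_le_nhds zero_lt_one)).and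
      (self_mem_nhdsWithin (s := Set.Ioi (0 : ℝ)) (a := 0)))).exists
  exact ⟨ε, hε3, hε2, hε1⟩

/-- Shifting the line of integration against a rescaled kernel of exponential type. -/
lemma integral_mul_kernel_shift {k F : ℂ → ℂ} {C M a β b T : ℝ} (hC0 : 0 ≤ C) (hM0 : 0 ≤ M)
    (hk : Differentiable ℂ k) (hkC : ∀ w, ‖k w‖ ≤ C * Real.exp (6 * |w.im|) / (1 + ‖w‖) ^ 4)
    (hb : 1 ≤ b) (hab : a ≤ β) (hF : ∀ s : ℂ, a ≤ s.re → s.re ≤ β → DifferentiableAt ℂ F s)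
    (hM : ∀ s : ℂ, a ≤ s.re → s.re ≤ β → ‖F s‖ ≤ M * (1 + |s.im|)) :
    MeasureTheory.Integrable (fun t : ℝ => F (a + t * Complex.I) * k (b * (t - T) : ℝ)) ∧
    MeasureTheory.Integrable (fun t : ℝ => F (β + t * Complex.I) *
      k (((b * (t - T) : ℝ) : ℂ) - (b * (β - a) : ℝ) * Complex.I)) ∧
    ∫ t : ℝ, F (a + t * Complex.I) * k (b * (t - T) : ℝ) =
      ∫ t : ℝ, F (β + t * Complex.I) *
        k (((b * (t - T) : ℝ) : ℂ) - (b * (β - a) : ℝ) * Complex.I) := by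
  set W : ℂ → ℂ := fun s => -Complex.I * b * (s - a - T * Complex.I) with hW
  have hWre : ∀ s : ℂ, (W s).re = b * (s.im - T) := fun s => by simp [hW]
  have hWim : ∀ s : ℂ, (W s).im = -(b * (s.re - a)) := fun s => by simp [hW]
  set f : ℂ → ℂ := fun s => F s * k (W s) with hf
  have hWd : Differentiable ℂ W := by fun_prop
  have hfd : ∀ s : ℂ, a ≤ s.re → s.re ≤ β → DifferentiableAt ℂ f s := fun s h1 h2 =>
    (hF s h1 h2).mul ((hk.comp hWd) s)
  have hfb : ∀ s : ℂ, a ≤ s.re → s.re ≤ β →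
      ‖f s‖ ≤ M * C * Real.exp (6 * (b * (β - a))) * (1 + |T|) ^ 3 / (1 + s.im ^ 2) := by
    intro s h1 h2
    have hk1 := hkC (W s)
    have him : |(W s).im| ≤ b * (β - a) := by
      rw [hWim, abs_neg, abs_of_nonneg (mul_nonneg (by linarith) (by linarith))]
      gcongr
    have hnorm : |s.im - T| ≤ ‖W s‖ := by
      refine le_trans ?_ (Complex.abs_re_le_norm (W s))
      rw [hWre, abs_mul, abs_of_nonneg (by linarith : 0 ≤ b)]
      nlinarith [abs_nonneg (s.im - T)]
    have htri : |s.im| ≤ |s.im - T| + |T| := by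
      have := abs_add_le (s.im - T) T
      simpa using this
    set u := ‖W s‖
    have hu : 0 ≤ u := norm_nonneg _
    have h1T : 1 + |s.im| ≤ (1 + |T|) * (1 + u) := by
      nlinarith [abs_nonneg T, abs_nonneg (s.im - T)]
    have h3 : (1 + |s.im|) * (1 + s.im ^ 2) ≤ (1 + |T|) ^ 3 * (1 + u) ^ 4 := by
      have hi := abs_nonneg s.im
      calc (1 + |s.im|) * (1 + s.im ^ 2) ≤ (1 + |s.im|) ^ 3 := by
            rw [← sq_abs s.im]
            nlinarith [mul_nonneg hi hi, mul_nonneg (mul_nonneg hi hi) hi]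
        _ ≤ ((1 + |T|) * (1 + u)) ^ 3 := by gcongr
        _ = (1 + |T|) ^ 3 * (1 + u) ^ 3 := by ring
        _ ≤ (1 + |T|) ^ 3 * (1 + u) ^ 4 := by
            gcongr
            · linarith
            · norm_num
    have h4 : 1 + |s.im| ≤ (1 + |T|) ^ 3 * (1 + u) ^ 4 / (1 + s.im ^ 2) := by
      rw [le_div_iff₀ (by positivity)]
      exact h3
    rw [hf]
    simp only [norm_mul]
    calc ‖F s‖ * ‖k (W s)‖ ≤ (M * ((1 + |T|) ^ 3 * (1 + u) ^ 4 / (1 + s.im ^ 2))) *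
          (C * Real.exp (6 * (b * (β - a))) / (1 + u) ^ 4) := by
          refine mul_le_mul ((hM s h1 h2).trans ?_) (hk1.trans ?_) (norm_nonneg _) (by positivity)
          · gcongr
          · gcongr
      _ = _ := by field_simp
  have hleft : ∀ t : ℝ, f (a + t * Complex.I) = F (a + t * Complex.I) * k (b * (t - T) : ℝ) := by
    intro t
    have : W (a + t * Complex.I) = ((b * (t - T) : ℝ) : ℂ) := by
      apply Complex.ext
      · simp [hWre]
      · simp [hWim]
    rw [hf]
    simp only [this]
  have hright : ∀ t : ℝ, f (β + t * Complex.I) = F (β + t * Complex.I) *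
      k (((b * (t - T) : ℝ) : ℂ) - (b * (β - a) : ℝ) * Complex.I) := by
    intro t
    have : W (β + t * Complex.I) = ((b * (t - T) : ℝ) : ℂ) - (b * (β - a) : ℝ) * Complex.I := by
      apply Complex.ext
      · rw [hWre]; simp
      · rw [hWim]; simp
    rw [hf]
    simp only [this]
  have h1 := integral_vertical_line_eq hab hfd hfb
  have h2 := integral_vertical_line_eq le_rfl (fun s h1 h2 => hfd s (hab.trans h1) h2)
    (fun s h1 h2 => hfb s (hab.trans h1) h2)
  simp only [hleft, hright] at h1 h2
  exact ⟨h1.1, h2.1, h1.2⟩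

lemma integral_ofReal_comp_mul_sub {k : ℂ → ℂ} {b T : ℝ} (hb : 0 < b)
    (hkim : ∀ x : ℝ, (k x).im = 0) :
    ∫ t : ℝ, k (b * (t - T) : ℝ) = (((∫ x : ℝ, (k x).re) / b : ℝ) : ℂ) := by
  have h1 : ∀ x : ℝ, k x = (((k x).re : ℝ) : ℂ) := fun x => by
    apply Complex.ext <;> simp [hkim]
  calc ∫ t : ℝ, k (b * (t - T) : ℝ) = ∫ t : ℝ, (((k (b * (t - T) : ℝ)).re : ℝ) : ℂ) := by
        congr 1; ext t; exact h1 _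
    _ = ((∫ t : ℝ, (k (b * (t - T) : ℝ)).re : ℝ) : ℂ) := integral_ofReal
    _ = _ := by
        rw [MeasureTheory.integral_sub_right_eq_self (fun t : ℝ => (k (b * t : ℝ)).re) T,
          MeasureTheory.Measure.integral_comp_mul_left (fun x : ℝ => (k x).re) b,
          abs_of_pos (inv_pos.2 hb), smul_eq_mul, inv_mul_eq_div]

/-- If `ξ` has no zero on a short segment of the critical line around height `T`, then
`Re (logDeriv ξ)` is small at `4 + iT`. -/
lemma exists_logDeriv_riemannXi_re_le (RH : RiemannHypothesis) :
    ∃ A > 0, ∃ D > 0, ∀ b ≥ (1 : ℝ), ∀ T : ℝ,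
      (∀ t ∈ Set.Icc (T - A / b) (T + A / b), riemannXi (1 / 2 + t * Complex.I) ≠ 0) →
      (logDeriv riemannXi (4 + T * Complex.I)).re ≤ D * Real.exp (22 * b) := by
  obtain ⟨k, A, C, hA, hC, hkd, hkC, hkim, hkneg, hκ⟩ := exists_kernel
  obtain ⟨C₁, hC₁0, hC₁⟩ := exists_norm_logDeriv_riemannXi_sub_le
  set κ := ∫ x : ℝ, (k x).re with hκdef
  refine ⟨A, hA, ((C₁ + 1) * C * Real.pi + 2 * A * C) / κ, by positivity, fun b hb T hT => ?_⟩
  have hb0 : 0 < b := by linarith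
  obtain ⟨ε, hε0, hε1, hε⟩ := exists_logDeriv_riemannXi_re_le_one isCompact_Icc hT
  set a : ℝ := 1 / 2 + ε with ha
  set H := logDeriv riemannXi with hH
  obtain ⟨M, hM0, hM⟩ := exists_norm_logDeriv_riemannXi_le_strip RH hε0 (le_refl 4)
  have hHd : ∀ s : ℂ, a ≤ s.re → s.re ≤ 4 → DifferentiableAt ℂ H s := fun s h1 _ =>
    (differentiable_riemannXi.deriv s).div (differentiable_riemannXi s)
      (riemannXi_ne_zero RH (by linarith))
  have hab : a ≤ 4 := by linarith
  set K : ℝ → ℂ := fun t => k (((b * (t - T) : ℝ) : ℂ) - (b * (4 - a) : ℝ) * Complex.I) with hKdef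
  obtain ⟨hi1, hi2, hi3⟩ := integral_mul_kernel_shift (T := T) hC.le hM0.le hkd hkC hb hab hHd hM
  obtain ⟨-, hj2, hj3⟩ := integral_mul_kernel_shift (F := fun _ => 1) (M := 1) (T := T) hC.le
    zero_le_one hkd hkC hb hab (fun s _ _ => by fun_prop) (fun s _ _ => by simp)
  simp only [one_mul] at hj2 hj3
  rw [integral_ofReal_comp_mul_sub hb0 hkim] at hj3
  have hKnorm : ∀ t, ‖K t‖ ≤ C * Real.exp (21 * b) / (1 + |t - T|) ^ 4 := by
    intro t
    refine (hkC _).trans ?_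
    have h1 : |(((b * (t - T) : ℝ) : ℂ) - (b * (4 - a) : ℝ) * Complex.I).im| ≤ 7 / 2 * b := by
      have : (((b * (t - T) : ℝ) : ℂ) - (b * (4 - a) : ℝ) * Complex.I).im = -(b * (4 - a)) := by
        simp
      rw [this, abs_neg, abs_of_nonneg (mul_nonneg hb0.le (by linarith))]
      nlinarith
    have h2 : |t - T| ≤ ‖((b * (t - T) : ℝ) : ℂ) - (b * (4 - a) : ℝ) * Complex.I‖ := by
      refine le_trans ?_ (Complex.abs_re_le_norm _)
      have : (((b * (t - T) : ℝ) : ℂ) - (b * (4 - a) : ℝ) * Complex.I).re = b * (t - T) := by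
        simp
      rw [this, abs_mul, abs_of_pos hb0]
      nlinarith [abs_nonneg (t - T)]
    exact div_le_div₀ (by positivity)
      (mul_le_mul_of_nonneg_left (Real.exp_le_exp.2 (by linarith)) hC.le) (by positivity)
      (by gcongr)
  set E : ℝ := (C₁ + 1) * C * Real.exp (21 * b) * Real.pi with hE
  have herr : ‖∫ t : ℝ, (H (4 + t * Complex.I) - H (4 + T * Complex.I)) * K t‖ ≤ E := by
    have hg : MeasureTheory.Integrable fun t : ℝ =>
        (C₁ + 1) * C * Real.exp (21 * b) * (1 + (t - T) ^ 2)⁻¹ :=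
      (integrable_inv_one_add_sq.comp_sub_right T).const_mul _
    refine (MeasureTheory.norm_integral_le_of_norm_le hg (Eventually.of_forall fun t => ?_)).trans
      (le_of_eq ?_)
    · have h1 := hC₁ (4 + t * Complex.I) (4 + T * Complex.I) (by simp) (by simp)
      have h2 : ‖(4 + t * Complex.I : ℂ) - (4 + T * Complex.I)‖ = |t - T| := by
        have : (4 + t * Complex.I : ℂ) - (4 + T * Complex.I) = ((t - T : ℝ) : ℂ) * Complex.I := by
          push_cast; ring
        rw [this, norm_mul, Complex.norm_I, mul_one, Complex.norm_real, Real.norm_eq_abs]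
      rw [h2] at h1
      have h0 := abs_nonneg (t - T)
      rw [norm_mul]
      calc _ ≤ ((C₁ + 1) * (1 + |t - T|)) * (C * Real.exp (21 * b) / (1 + |t - T|) ^ 4) := by
            refine mul_le_mul (h1.trans (by nlinarith)) (hKnorm t) (norm_nonneg _) (by positivity)
        _ = (C₁ + 1) * C * Real.exp (21 * b) * ((1 + |t - T|) ^ 3)⁻¹ := by field_simp
        _ ≤ _ := by
            gcongr
            rw [← sq_abs (t - T)]
            nlinarith [mul_nonneg h0 h0, mul_nonneg (mul_nonneg h0 h0) h0]
    · rw [MeasureTheory.integral_const_mul,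
        MeasureTheory.integral_sub_right_eq_self (fun t : ℝ => (1 + t ^ 2)⁻¹) T,
        integral_univ_inv_one_add_sq]
  have hsplit : ∫ t : ℝ, H (4 + t * Complex.I) * K t = H (4 + T * Complex.I) * ((κ / b : ℝ) : ℂ) +
      ∫ t : ℝ, (H (4 + t * Complex.I) - H (4 + T * Complex.I)) * K t := by
    have h1 : ∀ t : ℝ, (H (4 + t * Complex.I) - H (4 + T * Complex.I)) * K t =
        H (4 + t * Complex.I) * K t - H (4 + T * Complex.I) * K t := fun t => sub_mul _ _ _
    simp only [h1]
    rw [MeasureTheory.integral_sub (by simpa only [Complex.ofReal_ofNat] using hi2) (hj2.const_mul _),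
      MeasureTheory.integral_const_mul, ← hj3]
    ring
  have hupper : (∫ t : ℝ, H (a + t * Complex.I) * k (b * (t - T) : ℝ)).re ≤ 2 * A * C / b := by
    rw [← RCLike.re_eq_complex_re, ← integral_re hi1]
    have hind : MeasureTheory.Integrable
        ((Set.Icc (T - A / b) (T + A / b)).indicator fun _ : ℝ => C) :=
      (MeasureTheory.integrable_indicator_iff measurableSet_Icc).2
        (MeasureTheory.integrableOn_const (by simp))
    refine (MeasureTheory.integral_mono hi1.re hind fun t => ?_).trans (le_of_eq ?_)
    · have h1 : RCLike.re (H (a + t * Complex.I) * k (b * (t - T) : ℝ)) =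
          (H (a + t * Complex.I)).re * (k (b * (t - T) : ℝ)).re := by
        rw [RCLike.re_eq_complex_re, Complex.mul_re, hkim]
        ring
      have hnn : 0 ≤ (H (a + t * Complex.I)).re :=
        logDeriv_riemannXi_re_nonneg RH (by simp [ha]; linarith)
      simp only [h1]
      by_cases ht : t ∈ Set.Icc (T - A / b) (T + A / b)
      · rw [Set.indicator_of_mem ht]
        have h2 := hε t ht
        have h3 : (k (b * (t - T) : ℝ)).re ≤ C := by
          refine (Complex.re_le_norm _).trans ((hkC _).trans ?_)
          rw [Complex.ofReal_im, abs_zero, mul_zero, Real.exp_zero, mul_one]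
          exact div_le_self hC.le (one_le_pow₀ (by linarith [norm_nonneg ((b * (t - T) : ℝ) : ℂ)]))
        nlinarith
      · rw [Set.indicator_of_notMem ht]
        refine mul_nonpos_of_nonneg_of_nonpos hnn (hkneg _ ?_)
        rw [abs_mul, abs_of_pos hb0, mul_comm, ← div_le_iff₀ hb0]
        by_contra hlt
        have := abs_lt.1 (not_le.1 hlt)
        exact ht ⟨by linarith, by linarith⟩
    · rw [MeasureTheory.integral_indicator measurableSet_Icc, MeasureTheory.setIntegral_const]
      have : (0 : ℝ) ≤ T + A / b - (T - A / b) := by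
        have : 0 < A / b := by positivity
        linarith
      simp only [MeasureTheory.measureReal_def, Real.volume_Icc, ENNReal.toReal_ofReal this,
        smul_eq_mul]
      ring
  have hfinal : (H (4 + T * Complex.I)).re * (κ / b) - E ≤ 2 * A * C / b := by
    have h1 := (abs_le.1 ((Complex.abs_re_le_norm _).trans herr)).1
    have h2 : (∫ t : ℝ, H (a + t * Complex.I) * k (b * (t - T) : ℝ)).re =
        (∫ t : ℝ, H (4 + t * Complex.I) * K t).re := by
      rw [hi3]; simp [hKdef]
    rw [h2, hsplit, Complex.add_re, Complex.re_mul_ofReal] at hupper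
    linarith
  have hexpb : b ≤ Real.exp b := by linarith [Real.add_one_le_exp b]
  have hexp22 : Real.exp (22 * b) = Real.exp b * Real.exp (21 * b) := by
    rw [← Real.exp_add]; ring_nf
  have h22 : 1 ≤ Real.exp (22 * b) := Real.one_le_exp (by positivity)
  rw [div_mul_eq_mul_div, le_div_iff₀ hκ]
  have h3 : (H (4 + T * Complex.I)).re * κ ≤ b * E + 2 * A * C := by
    have h4 : (H (4 + T * Complex.I)).re * κ / b ≤ (b * E + 2 * A * C) / b := by
      rw [add_div, mul_div_cancel_left₀ _ hb0.ne', mul_div_assoc]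
      linarith
    exact (div_le_div_iff_of_pos_right hb0).1 h4
  refine h3.trans ?_
  have h5 : b * E ≤ (C₁ + 1) * C * Real.pi * Real.exp (22 * b) := by
    rw [hexp22, hE]
    calc _ = (C₁ + 1) * C * Real.pi * (b * Real.exp (21 * b)) := by ring
      _ ≤ _ := by gcongr
  have h6 : 2 * A * C ≤ 2 * A * C * Real.exp (22 * b) := le_mul_of_one_le_right (by positivity) h22
  linarith

/-- Under the Riemann hypothesis, every height `T` is within `O(1 / log log T)` of a zero on the
critical line. -/
lemma exists_riemannXi_eq_zero_near (RH : RiemannHypothesis) :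
    ∃ C > 0, ∀ᶠ T : ℝ in atTop, ∃ γ : ℝ, |γ - T| ≤ C / Real.log (Real.log T) ∧
      riemannXi (1 / 2 + γ * Complex.I) = 0 := by
  obtain ⟨A, hA, D, hD, hgap⟩ := exists_logDeriv_riemannXi_re_le RH
  obtain ⟨C, hC⟩ := exists_log_norm_le_logDeriv_riemannXi_re
  refine ⟨44 * A, by positivity, ?_⟩
  have hlog := Real.tendsto_log_atTop
  have hloglog : Tendsto (fun T : ℝ => Real.log (Real.log T)) atTop atTop := hlog.comp hlog
  have hexp : Tendsto (fun T : ℝ => Real.exp (Real.log (Real.log T) / 2)) atTop atTop :=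
    Real.tendsto_exp_atTop.comp (hloglog.atTop_div_const two_pos)
  filter_upwards [eventually_gt_atTop 0, hlog.eventually_gt_atTop 0,
    hloglog.eventually_ge_atTop 44, hexp.eventually_ge_atTop (2 * D + 2 * |C| + 2)]
    with T hT0 hT1 hT2 hT3
  by_contra hno
  push Not at hno
  have hb : 1 ≤ Real.log (Real.log T) / 44 := by linarith
  have h1 := hgap _ hb T (fun t ht => hno t (by
    rw [abs_le]
    have : A / (Real.log (Real.log T) / 44) = 44 * A / Real.log (Real.log T) := by
      field_simp
    rw [this] at ht
    exact ⟨by linarith [ht.1], by linarith [ht.2]⟩))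
  have h2 := hC (4 + T * Complex.I) (by simp)
  have h3 : Real.log T ≤ Real.log ‖(4 + T * Complex.I : ℂ)‖ := by
    refine Real.log_le_log hT0 ?_
    simpa [abs_of_pos hT0] using Complex.abs_im_le_norm (4 + T * Complex.I)
  have h4 : 22 * (Real.log (Real.log T) / 44) = Real.log (Real.log T) / 2 := by ring
  have h5 : Real.exp (Real.log (Real.log T) / 2) ^ 2 = Real.log T := by
    rw [← Real.exp_nat_mul]
    push_cast
    rw [mul_div_cancel₀ _ two_ne_zero, Real.exp_log hT1]
  rw [h4] at h1
  set y := Real.exp (Real.log (Real.log T) / 2)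
  nlinarith [le_abs_self C, abs_nonneg C]

lemma exp_theta_mul_norm_Gammaℝ (t : ℝ) :
    Complex.exp (Complex.I * theta t) * ‖(1 / 2 + Complex.I * t : ℂ).Gammaℝ‖ =
      (1 / 2 + Complex.I * t : ℂ).Gammaℝ := by
  set w : ℂ := 1 / 4 + Complex.I * t / 2 with hw
  have hG : Complex.Gamma w ≠ 0 := Complex.Gamma_ne_zero_of_re_pos (by simp [hw])
  have hpi : (Real.pi : ℂ) ≠ 0 := by exact_mod_cast Real.pi_ne_zero
  set Λ : ℂ := Real.log Real.pi * -w + Complex.log (Complex.Gamma w) with hΛ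
  have hexp : (1 / 2 + Complex.I * t : ℂ).Gammaℝ = Complex.exp Λ := by
    have h1 : (1 / 2 + Complex.I * t : ℂ) / 2 = w := by rw [hw]; ring
    rw [Complex.Gammaℝ_def, neg_div, h1, Complex.cpow_def_of_ne_zero hpi, hΛ, Complex.exp_add,
      Complex.exp_log hG, Complex.ofReal_log Real.pi_pos.le]
  have him : Λ.im = theta t := by
    rw [hΛ, theta, ← hw, Complex.add_im, Complex.im_ofReal_mul]
    simp [hw]
    ring
  rw [hexp, Complex.norm_exp, Complex.ofReal_exp, ← Complex.exp_add, ← him]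
  congr 1
  rw [mul_comm, add_comm, Complex.re_add_im]

lemma hardyZ_eq (t : ℝ) : hardyZ t = -(riemannXi (1 / 2 + t * Complex.I)).re /
    ((1 / 4 + t ^ 2) * ‖(1 / 2 + t * Complex.I : ℂ).Gammaℝ‖) := by
  have hne : (1 / 2 + t * Complex.I : ℂ).Gammaℝ ≠ 0 :=
    Complex.Gammaℝ_ne_zero_of_re_pos (by simp)
  have hs1 : (1 / 2 + t * Complex.I : ℂ) ≠ 1 := fun h => by
    have := congrArg Complex.re h
    norm_num at this
  have h1 := exp_theta_mul_norm_Gammaℝ t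
  rw [mul_comm Complex.I (t : ℂ)] at h1
  have h2 := riemannXi_eq (s := 1 / 2 + t * Complex.I) (by simp) hs1
  have h3 : (1 / 2 + t * Complex.I : ℂ) * (1 / 2 + t * Complex.I - 1) =
      ((-(1 / 4 + t ^ 2) : ℝ) : ℂ) := by
    push_cast
    linear_combination (t : ℂ) ^ 2 * Complex.I_sq
  set ρ := ‖(1 / 2 + t * Complex.I : ℂ).Gammaℝ‖ with hρ
  have h4 : riemannXi (1 / 2 + t * Complex.I) = ((-(1 / 4 + t ^ 2) * ρ : ℝ) : ℂ) *
      (Complex.exp (Complex.I * theta t) * riemannZeta (1 / 2 + Complex.I * t)) := by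
    rw [h2, h3, ← h1, mul_comm Complex.I (t : ℂ)]
    push_cast
    ring
  have hρ0 : 0 < ρ := norm_pos_iff.2 hne
  have h5 := congrArg Complex.re h4
  rw [Complex.re_ofReal_mul, ← hardyZ] at h5
  rw [h5]
  field_simp

lemma differentiable_hardyZ : Differentiable ℝ hardyZ := by
  intro t
  have hline : ∀ f : ℂ → ℂ, DifferentiableAt ℂ f (1 / 2 + t * Complex.I) →
      DifferentiableAt ℝ (fun u : ℝ => f (1 / 2 + u * Complex.I)) t := by
    intro f hf
    have h1 : DifferentiableAt ℝ (fun u : ℝ => (1 / 2 + u * Complex.I : ℂ)) t := by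
      have h2 : DifferentiableAt ℝ (fun u : ℝ => (u : ℂ)) t :=
        Complex.ofRealCLM.differentiableAt
      exact (h2.mul_const _).const_add _
    exact DifferentiableAt.comp (g := f) (f := fun u : ℝ => (1 / 2 + u * Complex.I : ℂ)) t
      (hf.restrictScalars ℝ) h1
  have hne : (1 / 2 + t * Complex.I : ℂ).Gammaℝ ≠ 0 :=
    Complex.Gammaℝ_ne_zero_of_re_pos (by simp)
  have hX : DifferentiableAt ℝ (fun u : ℝ => (riemannXi (1 / 2 + u * Complex.I)).re) t :=
    Complex.reCLM.differentiableAt.comp t (hline _ (differentiable_riemannXi _))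
  have hGd : DifferentiableAt ℂ Complex.Gammaℝ (1 / 2 + t * Complex.I) := by
    have h := (Complex.differentiable_Gammaℝ_inv (1 / 2 + t * Complex.I)).inv (inv_ne_zero hne)
    have e : (fun s : ℂ => s.Gammaℝ⁻¹)⁻¹ = Complex.Gammaℝ := by
      ext z
      simp
    rwa [e] at h
  have hG : DifferentiableAt ℝ (fun u : ℝ => ‖(1 / 2 + u * Complex.I : ℂ).Gammaℝ‖) t :=
    (hline _ hGd).norm ℝ hne
  have hfun : hardyZ = fun u : ℝ => -(riemannXi (1 / 2 + u * Complex.I)).re /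
    ((1 / 4 + u ^ 2) * ‖(1 / 2 + u * Complex.I : ℂ).Gammaℝ‖) := funext hardyZ_eq
  rw [hfun]
  refine hX.neg.div (DifferentiableAt.mul (by fun_prop) hG) ?_
  have := norm_pos_iff.2 hne
  positivity

lemma hardyZ_eq_zero_iff (t : ℝ) : hardyZ t = 0 ↔ riemannXi (1 / 2 + t * Complex.I) = 0 := by
  have h1 : 0 < ‖(1 / 2 + t * Complex.I : ℂ).Gammaℝ‖ :=
    norm_pos_iff.2 (Complex.Gammaℝ_ne_zero_of_re_pos (by simp))
  have h2 : (1 / 4 + t ^ 2) * ‖(1 / 2 + t * Complex.I : ℂ).Gammaℝ‖ ≠ 0 := by positivity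
  rw [hardyZ_eq, div_eq_zero_iff, or_iff_left h2, neg_eq_zero]
  exact ⟨fun h => Complex.ext h (riemannXi_critical_im t), fun h => by rw [h]; rfl⟩

lemma exists_hardyZ_ne_zero {a b : ℝ} (hab : a < b) : ∃ x ∈ Set.Ioo a b, hardyZ x ≠ 0 := by
  by_contra! h
  have han : AnalyticOnNhd ℂ (fun z : ℂ => riemannXi (1 / 2 + z * Complex.I)) Set.univ := by
    refine DifferentiableOn.analyticOnNhd (fun z _ => ?_) isOpen_univ
    refine DifferentiableAt.differentiableWithinAt ?_
    exact DifferentiableAt.comp (g := riemannXi) (f := fun z : ℂ => 1 / 2 + z * Complex.I) z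
      (differentiable_riemannXi _) (by fun_prop)
  set c := (a + b) / 2 with hc
  have hfreq : ∃ᶠ z in 𝓝[≠] (c : ℂ), riemannXi (1 / 2 + z * Complex.I) = 0 := by
    have htend : Tendsto (fun x : ℝ => (x : ℂ)) (𝓝[≠] c) (𝓝[≠] (c : ℂ)) :=
      tendsto_nhdsWithin_of_tendsto_nhds_of_eventually_within _
        ((Complex.continuous_ofReal.tendsto c).mono_left nhdsWithin_le_nhds)
        (eventually_nhdsWithin_of_forall fun x hx => by
          simpa using hx)
    refine htend.frequently (Eventually.frequently ?_)
    have hmem : Set.Ioo a b ∈ 𝓝 c := Ioo_mem_nhds (by linarith) (by linarith)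
    filter_upwards [mem_nhdsWithin_of_mem_nhds hmem] with x hx
    exact (hardyZ_eq_zero_iff x).1 (h x hx)
  have h0 := han.eqOn_zero_of_preconnected_of_frequently_eq_zero isPreconnected_univ
    (Set.mem_univ _) hfreq (Set.mem_univ (-Complex.I / 2))
  have h1 : (1 / 2 + -Complex.I / 2 * Complex.I : ℂ) = 1 := by
    linear_combination (-1 / 2 : ℂ) * Complex.I_sq
  simp only [h1, riemannXi_one, Pi.zero_apply] at h0
  exact one_ne_zero h0

/-- A differentiable function vanishing at both ends of an interval, but not in between, has a
derivative taking both signs. -/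
lemma exists_deriv_pos_and_neg {f : ℝ → ℝ} (hf : Differentiable ℝ f) {a x b : ℝ} (hax : a < x)
    (hxb : x < b) (ha : f a = 0) (hb : f b = 0) (hx : f x ≠ 0) :
    (∃ p ∈ Set.Ioo a b, 0 < deriv f p) ∧ ∃ q ∈ Set.Ioo a b, deriv f q < 0 := by
  obtain ⟨p, hp, hp'⟩ := exists_deriv_eq_slope f hax hf.continuous.continuousOn
    hf.differentiableOn
  obtain ⟨q, hq, hq'⟩ := exists_deriv_eq_slope f hxb hf.continuous.continuousOn
    hf.differentiableOn
  have hpm : p ∈ Set.Ioo a b := ⟨hp.1, hp.2.trans hxb⟩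
  have hqm : q ∈ Set.Ioo a b := ⟨hax.trans hq.1, hq.2⟩
  rw [ha, sub_zero] at hp'
  rw [hb, zero_sub] at hq'
  rcases lt_or_gt_of_ne hx with h | h
  · exact ⟨⟨q, hqm, hq' ▸ div_pos (by linarith) (by linarith)⟩,
      ⟨p, hpm, hp' ▸ div_neg_of_neg_of_pos h (by linarith)⟩⟩
  · exact ⟨⟨p, hpm, hp' ▸ div_pos h (by linarith)⟩,
      ⟨q, hqm, hq' ▸ div_neg_of_neg_of_pos (by linarith) (by linarith)⟩⟩

/-- Between consecutive zeros of Hardy's function one can pick points at which the derivative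
alternates in sign. -/
lemma exists_alternating_deriv_hardyZ {γ : ℕ → ℝ} (hγ : StrictMono γ)
    (h0 : ∀ j, hardyZ (γ j) = 0) :
    ∃ s : ℕ → ℝ, (∀ i, s i ∈ Set.Ioo (γ i) (γ (i + 1))) ∧
      ∀ i, deriv hardyZ (s i) * deriv hardyZ (s (i + 1)) < 0 := by
  have hex : ∀ i, ∃ p ∈ Set.Ioo (γ i) (γ (i + 1)), 0 < (-1 : ℝ) ^ i * deriv hardyZ p := by
    intro i
    obtain ⟨x, hx, hx0⟩ := exists_hardyZ_ne_zero (hγ (Nat.lt_succ_self i))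
    obtain ⟨⟨p, hp, hp'⟩, ⟨q, hq, hq'⟩⟩ := exists_deriv_pos_and_neg differentiable_hardyZ
      hx.1 hx.2 (h0 i) (h0 (i + 1)) hx0
    rcases neg_one_pow_eq_or ℝ i with h | h
    · exact ⟨p, hp, by rw [h]; linarith⟩
    · exact ⟨q, hq, by rw [h]; linarith⟩
  choose s hs hs' using hex
  refine ⟨s, hs, fun i => ?_⟩
  have h1 := mul_pos (hs' i) (hs' (i + 1))
  have h2 : (-1 : ℝ) ^ i * (-1) ^ i = 1 := by rw [← mul_pow]; simp
  rw [pow_succ] at h1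
  nlinarith

/-- On RH, there is `B > 0` such that for all sufficiently large `T`, with
`m = ⌊B·ln ln T / ln ln ln T⌋`, the interval `(T, T + 1/ln ln ln T)` contains points
`s₀ < s₁ < … < s_m` with `Z'(s_i)·Z'(s_{i+1}) < 0` for each `i < m`. -/
theorem many_sign_changes_RH (RH : RiemannHypothesis) :
    ∃ B > (0:ℝ), ∀ᶠ T in Filter.atTop,
      ∃ s : ℕ → ℝ,
        (∀ i ≤ ⌊B * Real.log (Real.log T) / Real.log (Real.log (Real.log T))⌋₊,
          s i ∈ Set.Ioo T (T + 1 / Real.log (Real.log (Real.log T)))) ∧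
        (∀ i < ⌊B * Real.log (Real.log T) / Real.log (Real.log (Real.log T))⌋₊,
          s i < s (i + 1)) ∧
        (∀ i < ⌊B * Real.log (Real.log T) / Real.log (Real.log (Real.log T))⌋₊,
          deriv hardyZ (s i) * deriv hardyZ (s (i + 1)) < 0) := by
  obtain ⟨C, hC, hev⟩ := exists_riemannXi_eq_zero_near RH
  obtain ⟨T₀, hT₀⟩ := eventually_atTop.1 hev
  refine ⟨1 / (6 * C), by positivity, ?_⟩
  have hlog := Real.tendsto_log_atTop
  have hloglog : Tendsto (fun T : ℝ => Real.log (Real.log T)) atTop atTop := hlog.comp hlog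
  have hsmall : ∀ᶠ y : ℝ in atTop, 12 * C * Real.log y ≤ y := by
    have h := Real.isLittleO_log_id_atTop.bound (show 0 < 1 / (12 * C) by positivity)
    filter_upwards [h, eventually_ge_atTop 0] with y hy hy0
    have h1 := (le_abs_self _).trans hy
    rw [id, Real.norm_eq_abs, abs_of_nonneg hy0, div_mul_eq_mul_div, one_mul,
      le_div_iff₀ (by positivity)] at h1
    linarith
  filter_upwards [eventually_ge_atTop T₀, eventually_gt_atTop 0, hlog.eventually_gt_atTop 0,
    hloglog.eventually_gt_atTop 0, (hlog.comp hloglog).eventually_gt_atTop 0,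
    hloglog.eventually hsmall] with T h1 h2 h3 h4 h5 h6
  simp only [Function.comp] at h5
  set y := Real.log (Real.log T) with hy
  set z := Real.log y with hz
  set r := C / y with hr
  have hr0 : 0 < r := by positivity
  have hex : ∀ j : ℕ, ∃ γ : ℝ, |γ - (T + (3 * j + 2) * r)| ≤ r ∧ hardyZ γ = 0 := by
    intro j
    have hle : T ≤ T + (3 * j + 2) * r := by
      have : 0 ≤ (3 * j + 2) * r := by positivity
      linarith
    obtain ⟨γ, hγ1, hγ2⟩ := hT₀ _ (h1.trans hle)
    refine ⟨γ, hγ1.trans ?_, (hardyZ_eq_zero_iff γ).2 hγ2⟩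
    rw [hr]
    gcongr
    exact Real.log_le_log h3 (Real.log_le_log h2 hle)
  choose γ hγ hγ0 using hex
  have hbd : ∀ j : ℕ, T + (3 * j + 1) * r ≤ γ j ∧ γ j ≤ T + (3 * j + 3) * r := fun j => by
    have := abs_le.1 (hγ j)
    exact ⟨by linarith, by linarith⟩
  have hmono : StrictMono γ := strictMono_nat_of_lt_succ fun j => by
    have h7 := (hbd j).2
    have h8 := (hbd (j + 1)).1
    push_cast at h8
    linarith
  obtain ⟨s, hs, hs'⟩ := exists_alternating_deriv_hardyZ hmono hγ0
  refine ⟨s, fun i hi => ⟨?_, ?_⟩, fun i _ => (hs i).2.trans (hs (i + 1)).1, fun i _ => hs' i⟩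
  · have h7 := (hbd 0).1
    have h8 := hmono.monotone (Nat.zero_le i)
    push_cast at h7
    linarith [(hs i).1]
  · have h7 := (hbd (i + 1)).2
    have h8 : (i : ℝ) ≤ 1 / (6 * C) * y / z := (Nat.le_floor_iff (by positivity)).1 hi
    push_cast at h7
    refine (hs i).2.trans_le (h7.trans ?_)
    have h9 : (3 * i : ℝ) * r ≤ 1 / (2 * z) := by
      calc (3 * i : ℝ) * r ≤ 3 * (1 / (6 * C) * y / z) * r := by gcongr
        _ = 1 / (2 * z) := by rw [hr]; field_simp; norm_num
    have h10 : 6 * r ≤ 1 / (2 * z) := by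
      rw [hr, le_div_iff₀ (by positivity), ← mul_div_assoc, div_mul_eq_mul_div,
        div_le_one h4]
      linarith
    have h11 : 1 / z = 1 / (2 * z) + 1 / (2 * z) := by field_simp; norm_num
    rw [h11]
    linarith
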